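/- Let d ≥ 1 and let p, q satisfy 1 < q ≤ 1 + 2/d and 2/p + d/q = d. Then there is a constant C = C(d,q) > 0 such that for every (possibly infinite) orthonormal system (u_j) in L²(ℝ^d) and every sequence of complex coefficients (n_j) one has ∫_ℝ ( ∫_{ℝ^d} | Σ_j n_j |(e^{itΔ}u_j)(x)|² |^q dx )^{p/q} dt ≤ C^p ( Σ_j |n_j|^{2q/(q+1)} )^{p(q+1)/(2q)}. -/

import Mathlib

noncomputable section

open MeasureTheory Complex Filter
open scoped ENNReal NNReal Real InnerProductSpace FourierTransform ComplexOrder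

/-- Euclidean space `ℝ^d`. -/
abbrev Rd (d : ℕ) : Type := EuclideanSpace ℝ (Fin d)

/-- The Hilbert space `L²(ℝ^d, ℂ)`. -/
abbrev L2 (d : ℕ) : Type := MeasureTheory.Lp ℂ 2 (volume : Measure (Rd d))

/-- `U` is the free Schrödinger propagator family `t ↦ e^{itΔ}` on `L²(ℝ^d)`: it is
(uniquely) characterized by the fact that for a Schwartz initial datum `f`, `(U t) f` is the
Schwartz function whose (Mathlib-normalized) Fourier transform is `e^{-4π²it|ξ|²} (𝓕 f)(ξ)`,
i.e. `U t` is the unitary Fourier multiplier with symbol `e^{-it|ξ|²}` in the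
`(2π)^{-d/2} ∫ e^{-ix·ξ}` normalization of the Fourier transform. -/
def IsSchrodingerPropagator {d : ℕ} (U : ℝ → (L2 d ≃ₗᵢ[ℂ] L2 d)) : Prop :=
  ∀ (t : ℝ) (f g : SchwartzMap (Rd d) ℂ) (u : L2 d),
    (u : Rd d → ℂ) =ᵐ[volume] f →
    (∀ ξ : Rd d, 𝓕 (g : Rd d → ℂ) ξ
        = Complex.exp (-(Complex.I * t * (4 * (π : ℂ) ^ 2 * (‖ξ‖ : ℂ) ^ 2))) * 𝓕 (f : Rd d → ℂ) ξ) →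
    ((U t) u : Rd d → ℂ) =ᵐ[volume] g

section Plancherel

variable {V : Type*} [NormedAddCommGroup V] [InnerProductSpace ℝ V] [FiniteDimensional ℝ V]
  [MeasurableSpace V] [BorelSpace V]

theorem integral_fourier_mul_eq {f g : V → ℂ} (hf : Integrable f) (hg : Integrable g) :
    ∫ x, 𝓕 g x * f x = ∫ x, g x * 𝓕 f x := by
  have := VectorFourier.integral_fourierIntegral_smul_eq_flip (μ := volume) (ν := volume)
    (L := innerₗ V) (f := g) (g := f) Real.continuous_fourierChar continuous_inner hg hf
  simpa [Real.fourier_eq, VectorFourier.fourierIntegral, flip_innerₗ] using this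

theorem continuous_fourier_of_integrable {f : V → ℂ} (hf : Integrable f) :
    Continuous (𝓕 f) :=
  VectorFourier.fourierIntegral_continuous Real.continuous_fourierChar continuous_inner hf

/-- On `L¹ ∩ L²` the Fourier integral agrees with the `L²` Fourier transform. -/
theorem fourier_toLp_ae_eq {f : V → ℂ} (hf : Integrable f) (hf2 : MemLp f 2) :
    (𝓕 (hf2.toLp f) : Lp ℂ 2 (volume : Measure V)) =ᵐ[volume] 𝓕 f := by
  apply ae_eq_of_integral_contDiff_smul_eq
  · exact (Lp.memLp _).locallyIntegrable (by norm_num)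
  · exact (continuous_fourier_of_integrable hf).locallyIntegrable
  intro g hg hgc
  have hgc' : HasCompactSupport (fun x => (g x : ℂ)) := hgc.comp_left (g := fun r : ℝ => (r : ℂ)) (by simp)
  have hg' : ContDiff ℝ ((⊤ : ℕ∞) : WithTop ℕ∞) (fun x => (g x : ℂ)) := Complex.ofRealCLM.contDiff.comp hg
  set G : SchwartzMap V ℂ := hgc'.toSchwartzMap hg' with hG
  have hGx : ∀ x, G x = g x := fun x => rfl
  have h := congrArg (fun T => T G) (Lp.fourier_toTemperedDistribution_eq (hf2.toLp f))
  simp only [TemperedDistribution.fourier_apply, Lp.toTemperedDistribution_apply] at h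
  have e1 : ∫ x, g x • (𝓕 (hf2.toLp f) : Lp ℂ 2 (volume : Measure V)) x
      = ∫ x, (𝓕 G) x • (hf2.toLp f) x := by
    rw [h]; simp [hGx]
  rw [e1]
  have e2 : ∫ x, (𝓕 G) x • (hf2.toLp f) x = ∫ x, (𝓕 (G : V → ℂ)) x * f x := by
    apply integral_congr_ae
    filter_upwards [hf2.coeFn_toLp] with x hx
    rw [hx, SchwartzMap.fourier_coe]; rfl
  rw [e2, integral_fourier_mul_eq hf G.integrable]
  simp [hGx]

theorem eLpNorm_fourier_eq {f : V → ℂ} (hf : Integrable f) (hf2 : MemLp f 2) :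
    eLpNorm (𝓕 f) 2 volume = eLpNorm f 2 volume := by
  rw [← eLpNorm_congr_ae (fourier_toLp_ae_eq hf hf2), ← eLpNorm_congr_ae hf2.coeFn_toLp]
  have := Lp.norm_fourier_eq (hf2.toLp f)
  rw [Lp.norm_def, Lp.norm_def] at this
  exact (ENNReal.toReal_eq_toReal_iff' (Lp.eLpNorm_ne_top _) (Lp.eLpNorm_ne_top _)).1 this

theorem eLpNorm_two_sq {α : Type*} [MeasurableSpace α] (μ : Measure α) (f : α → ℂ) :
    eLpNorm f 2 μ ^ 2 = ∫⁻ x, ‖f x‖ₑ ^ 2 ∂μ := by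
  rw [eLpNorm_eq_lintegral_rpow_enorm_toReal (by norm_num) (by norm_num)]
  simp only [ENNReal.toReal_ofNat, ENNReal.rpow_ofNat]
  rw [← ENNReal.rpow_natCast, ← ENNReal.rpow_mul]
  norm_num

theorem lintegral_fourier_sq {f : V → ℂ} (hf : Integrable f) (hf2 : MemLp f 2) :
    ∫⁻ w, ‖𝓕 f w‖ₑ ^ 2 = ∫⁻ x, ‖f x‖ₑ ^ 2 := by
  rw [← eLpNorm_two_sq, ← eLpNorm_two_sq, eLpNorm_fourier_eq hf hf2]

end Plancherel

/-- The plane wave `e^{2πi(ωt + ⟨x,ξ⟩)}` on space-time, `z = (ω, ξ)`, `X = (t, x)`. -/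
def wave {d : ℕ} (z X : ℝ × Rd d) : ℂ :=
  cexp ((2 * π * (z.1 * X.1 + ⟪X.2, z.2⟫_ℝ) : ℝ) * I)

section Waves

variable {d : ℕ}

theorem continuous_wave : Continuous fun p : (ℝ × Rd d) × (ℝ × Rd d) => wave p.1 p.2 := by
  unfold wave; fun_prop

theorem norm_wave (z X : ℝ × Rd d) : ‖wave z X‖ = 1 := norm_exp_ofReal_mul_I _

theorem conj_wave (z X : ℝ × Rd d) :
    (starRingEnd ℂ) (wave z X) = cexp ((-(2 * π * (z.1 * X.1 + ⟪X.2, z.2⟫_ℝ)) : ℝ) * I) := by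
  rw [wave, ← Complex.exp_conj]
  simp only [map_mul, conj_ofReal, conj_I, ofReal_neg]
  ring_nf

theorem wave_mul_conj (z X Y : ℝ × Rd d) :
    wave z X * (starRingEnd ℂ) (wave z Y) = wave z (X - Y) := by
  rw [conj_wave, wave, wave, ← Complex.exp_add, ← add_mul, ← ofReal_add]
  congr 3
  simp only [Prod.fst_sub, Prod.snd_sub, inner_sub_left]
  ring

theorem lintegral_wave_sq {E : ℝ × Rd d → ℂ} (hE : Integrable E) (hE2 : MemLp E 2) :
    ∫⁻ z, ‖∫ X, (starRingEnd ℂ) (wave z X) * E X‖ₑ ^ 2 = ∫⁻ X, ‖E X‖ₑ ^ 2 := by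
  have hmp := WithLp.volume_preserving_ofLp ℝ (Rd d)
  have hme : MeasurableEmbedding (WithLp.ofLp : WithLp 2 (ℝ × Rd d) → ℝ × Rd d) :=
    (MeasurableEquiv.toLp 2 (ℝ × Rd d)).symm.measurableEmbedding
  have h1 : Integrable (E ∘ WithLp.ofLp : WithLp 2 (ℝ × Rd d) → ℂ) :=
    (hmp.integrable_comp_emb hme).2 hE
  have h2 : MemLp (E ∘ WithLp.ofLp : WithLp 2 (ℝ × Rd d) → ℂ) 2 :=
    hE2.comp_measurePreserving hmp
  have h := lintegral_fourier_sq h1 h2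
  rw [← hmp.lintegral_comp_emb hme, ← hmp.lintegral_comp_emb hme]
  refine Eq.trans (lintegral_congr fun w => ?_) h
  congr 2
  rw [Real.fourier_eq', ← hmp.integral_comp hme]
  congr 1 with v
  rw [conj_wave, smul_eq_mul, Function.comp_apply]
  congr 4
  simp only [WithLp.prod_inner_apply]
  simp

theorem integral_kernel_fubini {Z X : Type*} [MeasurableSpace Z] [MeasurableSpace X]
    {ζ : Measure Z} {μ : Measure X} [SFinite ζ] [SFinite μ] {a : Z → ℂ} {b : Z → X → ℂ}
    {E F : X → ℂ} (ha : Integrable a ζ) (hb : Measurable (Function.uncurry b))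
    (hb1 : ∀ z x, ‖b z x‖ ≤ 1) (hE : Integrable E μ) (hF : Integrable F μ) :
    ∫ p : X × X, (starRingEnd ℂ) (E p.1)
        * (∫ z, a z * (b z p.1 * (starRingEnd ℂ) (b z p.2)) ∂ζ) * F p.2 ∂(μ.prod μ)
      = ∫ z, a z * ((starRingEnd ℂ) (∫ x, (starRingEnd ℂ) (b z x) * E x ∂μ)
        * ∫ x, (starRingEnd ℂ) (b z x) * F x ∂μ) ∂ζ := by
  have hconj : Continuous (starRingEnd ℂ) := Complex.continuous_conj
  have hb' : Measurable fun p : Z × X => b p.1 p.2 := hb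
  have hEc : Integrable (fun x => (starRingEnd ℂ) (E x)) μ :=
    (LinearIsometryEquiv.integrable_comp_iff Complex.conjLIE).2 hE
  have hint : Integrable (Function.uncurry fun (p : X × X) (z : Z) =>
      a z * (((starRingEnd ℂ) ((starRingEnd ℂ) (b z p.1) * E p.1))
        * ((starRingEnd ℂ) (b z p.2) * F p.2))) ((μ.prod μ).prod ζ) := by
    refine Integrable.mono ((hEc.mul_prod hF).mul_prod ha) ?_ ?_
    · have m1 : Measurable fun q : (X × X) × Z => b q.2 q.1.1 :=
        hb'.comp (by fun_prop : Measurable fun q : (X × X) × Z => (q.2, q.1.1))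
      have m2 : Measurable fun q : (X × X) × Z => b q.2 q.1.2 :=
        hb'.comp (by fun_prop : Measurable fun q : (X × X) × Z => (q.2, q.1.2))
      have e1 : AEStronglyMeasurable (fun q : (X × X) × Z => E q.1.1) ((μ.prod μ).prod ζ) :=
        hE.1.comp_fst.comp_fst
      have e2 : AEStronglyMeasurable (fun q : (X × X) × Z => F q.1.2) ((μ.prod μ).prod ζ) :=
        (hF.1.comp_snd (μ := μ)).comp_fst
      have e3 : AEStronglyMeasurable (fun q : (X × X) × Z => a q.2) ((μ.prod μ).prod ζ) :=
        ha.1.comp_snd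
      refine e3.mul (AEStronglyMeasurable.mul ?_ ?_)
      · exact hconj.comp_aestronglyMeasurable
          ((hconj.measurable.comp m1).aestronglyMeasurable.mul e1)
      · exact (hconj.measurable.comp m2).aestronglyMeasurable.mul e2
    · refine Eventually.of_forall fun q => ?_
      simp only [Function.uncurry, norm_mul, RCLike.norm_conj]
      have h1 := hb1 q.2 q.1.1
      have h2 := hb1 q.2 q.1.2
      calc ‖a q.2‖ * (‖b q.2 q.1.1‖ * ‖E q.1.1‖ * (‖b q.2 q.1.2‖ * ‖F q.1.2‖))
          ≤ ‖a q.2‖ * (1 * ‖E q.1.1‖ * (1 * ‖F q.1.2‖)) := by gcongr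
        _ = ‖E q.1.1‖ * ‖F q.1.2‖ * ‖a q.2‖ := by ring
  calc _ = ∫ p : X × X, ∫ z, a z * (((starRingEnd ℂ) ((starRingEnd ℂ) (b z p.1) * E p.1))
        * ((starRingEnd ℂ) (b z p.2) * F p.2)) ∂ζ ∂(μ.prod μ) := by
        congr 1 with p
        rw [← integral_const_mul, ← integral_mul_const]
        congr 1 with z
        simp only [map_mul, Complex.conj_conj]
        ring
    _ = ∫ z, ∫ p : X × X, a z * (((starRingEnd ℂ) ((starRingEnd ℂ) (b z p.1) * E p.1))
        * ((starRingEnd ℂ) (b z p.2) * F p.2)) ∂(μ.prod μ) ∂ζ := integral_integral_swap hint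
    _ = _ := by
        congr 1 with z
        rw [integral_const_mul, integral_prod_mul (fun x => (starRingEnd ℂ) ((starRingEnd ℂ) (b z x) * E x)) (fun x => (starRingEnd ℂ) (b z x) * F x), integral_conj]

/-- The modulated plane wave whose frequencies sit on a translate of the paraboloid. -/
def pwave {d : ℕ} (z X : ℝ × Rd d) : ℂ := wave (z.1 - 2 * π * ‖z.2‖ ^ 2, z.2) X

theorem continuous_pwave : Continuous fun p : (ℝ × Rd d) × (ℝ × Rd d) => pwave p.1 p.2 := by
  unfold pwave wave; fun_prop

theorem norm_pwave (z X : ℝ × Rd d) : ‖pwave z X‖ = 1 := norm_wave _ _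

theorem pwave_mul_conj (z X Y : ℝ × Rd d) :
    pwave z X * (starRingEnd ℂ) (pwave z Y) = pwave z (X - Y) := wave_mul_conj _ _ _

theorem continuous_integral_wave {E : ℝ × Rd d → ℂ} (hE : Integrable E) :
    Continuous fun z => ∫ X, (starRingEnd ℂ) (wave z X) * E X := by
  refine continuous_of_dominated (bound := fun X => ‖E X‖) (fun z => ?_) (fun z => ?_) hE.norm
    (Eventually.of_forall fun X => ?_)
  · exact (Complex.continuous_conj.comp (continuous_wave.comp
      (by fun_prop : Continuous fun X : ℝ × Rd d => (z, X)))).aestronglyMeasurable.mul hE.1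
  · exact Eventually.of_forall fun X => by simp [norm_wave]
  · exact (Complex.continuous_conj.comp (continuous_wave.comp
      (by fun_prop : Continuous fun z : ℝ × Rd d => (z, X)))).mul continuous_const

theorem lintegral_shear {g : ℝ × Rd d → ℝ≥0∞} (hg : Measurable g) :
    ∫⁻ z : ℝ × Rd d, g (z.1 - 2 * π * ‖z.2‖ ^ 2, z.2) = ∫⁻ z, g z := by
  have : Measurable fun z : ℝ × Rd d => g (z.1 - 2 * π * ‖z.2‖ ^ 2, z.2) := by fun_prop
  rw [Measure.volume_eq_prod, lintegral_prod_symm _ this.aemeasurable,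
    lintegral_prod_symm _ hg.aemeasurable]
  congr 1 with ξ
  exact lintegral_sub_right_eq_self (μ := (volume : Measure ℝ)) (fun ω => g (ω, ξ))
    (2 * π * ‖ξ‖ ^ 2)

theorem lintegral_pwave_sq {E : ℝ × Rd d → ℂ} (hE : Integrable E) (hE2 : MemLp E 2) :
    ∫⁻ z, ‖∫ X, (starRingEnd ℂ) (pwave z X) * E X‖ₑ ^ 2 = ∫⁻ X, ‖E X‖ₑ ^ 2 := by
  rw [← lintegral_wave_sq hE hE2]
  exact lintegral_shear (g := fun z => ‖∫ X, (starRingEnd ℂ) (wave z X) * E X‖ₑ ^ 2)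
    (by have := (continuous_integral_wave hE).measurable; fun_prop)

/-- `L²` boundedness of a space-time Fourier multiplier, tested on pairs. -/
theorem norm_integral_multiplier_le {a : ℝ × Rd d → ℂ} {B : ℝ} {E F : ℝ × Rd d → ℂ}
    (ha : Integrable a) (haB : ∀ z, ‖a z‖ ≤ B)
    (hE : Integrable E) (hE2 : MemLp E 2) (hF : Integrable F) (hF2 : MemLp F 2)
    (hE1 : ∫⁻ X, ‖E X‖ₑ ^ 2 ≤ 1) (hF1 : ∫⁻ X, ‖F X‖ₑ ^ 2 ≤ 1) :
    ‖∫ p : (ℝ × Rd d) × (ℝ × Rd d), (starRingEnd ℂ) (E p.1)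
        * (∫ z, a z * pwave z (p.1 - p.2)) * F p.2‖ ≤ B := by
  have hB : 0 ≤ B := (norm_nonneg _).trans (haB 0)
  have h := integral_kernel_fubini (b := fun z X => pwave z X) ha continuous_pwave.measurable
    (fun z X => (norm_pwave z X).le) hE hF
  simp only [pwave_mul_conj] at h
  rw [Measure.volume_eq_prod ((ℝ × Rd d)), h]
  have key : ‖∫ z, a z * ((starRingEnd ℂ) (∫ x, (starRingEnd ℂ) (pwave z x) * E x)
        * ∫ x, (starRingEnd ℂ) (pwave z x) * F x)‖ₑ ≤ ENNReal.ofReal B := by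
    refine (enorm_integral_le_lintegral_enorm _).trans ?_
    have hm1 : Measurable fun z => ‖∫ x, (starRingEnd ℂ) (pwave z x) * E x‖ₑ ^ 2 := by
      have := ((continuous_integral_wave hE).comp (by fun_prop :
        Continuous fun z : ℝ × Rd d => (z.1 - 2 * π * ‖z.2‖ ^ 2, z.2))).measurable.enorm.pow_const 2
      exact this
    calc _ ≤ ∫⁻ z, ENNReal.ofReal B *
            (2⁻¹ * (‖∫ x, (starRingEnd ℂ) (pwave z x) * E x‖ₑ ^ 2
              + ‖∫ x, (starRingEnd ℂ) (pwave z x) * F x‖ₑ ^ 2)) := by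
          refine lintegral_mono fun z => ?_
          rw [enorm_mul, enorm_mul, RCLike.enorm_conj]
          refine mul_le_mul' ?_ ?_
          · rw [← ofReal_norm]; exact ENNReal.ofReal_le_ofReal (haB z)
          · have := ENNReal.young_inequality ‖∫ x, (starRingEnd ℂ) (pwave z x) * E x‖ₑ
              ‖∫ x, (starRingEnd ℂ) (pwave z x) * F x‖ₑ Real.HolderConjugate.two_two
            simp only [ENNReal.rpow_ofNat, ENNReal.ofReal_ofNat] at this
            refine this.trans (le_of_eq ?_)
            rw [ENNReal.div_eq_inv_mul, ENNReal.div_eq_inv_mul, mul_add]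
      _ = ENNReal.ofReal B * (2⁻¹ * ((∫⁻ X, ‖E X‖ₑ ^ 2) + ∫⁻ X, ‖F X‖ₑ ^ 2)) := by
          rw [lintegral_const_mul' _ _ ENNReal.ofReal_ne_top,
            lintegral_const_mul' _ _ (by simp), lintegral_add_left hm1,
            lintegral_pwave_sq hE hE2, lintegral_pwave_sq hF hF2]
      _ ≤ ENNReal.ofReal B * (2⁻¹ * (1 + 1)) := by gcongr
      _ = ENNReal.ofReal B := by
          rw [one_add_one_eq_two, ENNReal.inv_mul_cancel (by simp) (by simp), mul_one]
  rw [← ofReal_norm] at key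
  exact (ENNReal.ofReal_le_ofReal_iff hB).1 key

end Waves

/-- The Gaussian-regularised free Schrödinger kernel. -/
def regKernel {d : ℕ} (ε : ℝ) (X : ℝ × Rd d) : ℂ :=
  ∫ ξ : Rd d, (Real.exp (-(4 * π ^ 2 * ε * ‖ξ‖ ^ 2)) : ℂ) * pwave (0, ξ) X

/-- The sesquilinear form of convolution with `K`. -/
def bform {d : ℕ} (K E F : ℝ × Rd d → ℂ) : ℂ :=
  ∫ p : (ℝ × Rd d) × (ℝ × Rd d), (starRingEnd ℂ) (E p.1) * K (p.1 - p.2) * F p.2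

section Kernel

variable {d : ℕ}

theorem integrable_gaussian_rd {c : ℝ} (hc : 0 < c) :
    Integrable fun ξ : Rd d => Real.exp (-(c * ‖ξ‖ ^ 2)) := by
  have h := (GaussianFourier.integrable_cexp_neg_mul_sq_norm_add (V := Rd d) (b := c)
    (by simpa using hc) 0 0).norm
  refine h.congr (Eventually.of_forall fun ξ => ?_)
  simp only [zero_mul, add_zero, Complex.norm_exp]
  congr 1
  rw [← ofReal_pow, ← ofReal_neg, ← ofReal_mul, ofReal_re]
  ring

theorem integrable_gaussian_pwave {ε : ℝ} (hε : 0 < ε) (X : ℝ × Rd d) :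
    Integrable fun ξ : Rd d => (Real.exp (-(4 * π ^ 2 * ε * ‖ξ‖ ^ 2)) : ℂ) * pwave (0, ξ) X := by
  have h := integrable_gaussian_rd (d := d) (c := 4 * π ^ 2 * ε) (by positivity)
  refine h.mono (Continuous.aestronglyMeasurable ?_) (Eventually.of_forall fun ξ => ?_)
  · unfold pwave wave; fun_prop
  · rw [norm_mul, norm_pwave, mul_one, norm_real]

theorem continuous_regKernel {ε : ℝ} (hε : 0 < ε) : Continuous (regKernel (d := d) ε) := by
  have h := integrable_gaussian_rd (d := d) (c := 4 * π ^ 2 * ε) (by positivity)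
  refine continuous_of_dominated (fun X => (integrable_gaussian_pwave hε X).1)
    (fun X => Eventually.of_forall fun ξ => ?_) h (Eventually.of_forall fun ξ => ?_)
  · rw [norm_mul, norm_pwave, mul_one, norm_real, Real.norm_of_nonneg (Real.exp_nonneg _)]
  · unfold pwave wave; fun_prop

theorem norm_regKernel_le {ε : ℝ} (hε : 0 < ε) (X : ℝ × Rd d) {r : ℝ} (hr : 0 < r)
    (hr' : r ≤ ε ∨ r ≤ |X.1|) : ‖regKernel ε X‖ ≤ r ^ (-(d / 2 : ℝ)) := by
  set b : ℂ := 4 * π ^ 2 * (ε + X.1 * I) with hb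
  have hbre : b.re = 4 * π ^ 2 * ε := by simp [hb, ← ofReal_pow]
  have hb0 : 0 < b.re := by rw [hbre]; positivity
  have hform : regKernel ε X = (π / b) ^ ((d / 2 : ℝ) : ℂ) * cexp (-π ^ 2 * ‖-X.2‖ ^ 2 / b) := by
    have h := fourier_gaussian_innerProductSpace hb0 (-X.2)
    rw [finrank_euclideanSpace_fin] at h
    push_cast
    rw [← h, Real.fourier_eq', regKernel]
    congr 1 with ξ
    rw [pwave, wave, smul_eq_mul, ofReal_exp, ← Complex.exp_add, ← Complex.exp_add, hb]
    congr 1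
    simp only [inner_neg_right, real_inner_comm X.2 ξ]
    push_cast
    ring
  rw [hform, norm_mul, Complex.norm_cpow_real]
  have h1 : ‖cexp (-π ^ 2 * ‖-X.2‖ ^ 2 / b)‖ ≤ 1 := by
    rw [Complex.norm_exp, Real.exp_le_one_iff]
    have : (-π ^ 2 * ‖-X.2‖ ^ 2 / b : ℂ) = ((-(π ^ 2 * ‖-X.2‖ ^ 2) : ℝ) : ℂ) * b⁻¹ := by
      push_cast; ring
    rw [this, re_ofReal_mul, Complex.inv_re]
    have : 0 ≤ b.re / normSq b := div_nonneg hb0.le (normSq_nonneg _)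
    nlinarith [mul_nonneg (by positivity : (0:ℝ) ≤ π ^ 2 * ‖-X.2‖ ^ 2) this]
  have hrb : r ≤ ‖(ε + X.1 * I : ℂ)‖ := by
    rcases hr' with h | h
    · refine h.trans ?_
      have := Complex.abs_re_le_norm (ε + X.1 * I : ℂ)
      simpa [abs_of_pos hε] using this
    · refine h.trans ?_
      have := Complex.abs_im_le_norm (ε + X.1 * I : ℂ)
      simpa using this
  have h2 : ‖(π / b : ℂ)‖ ≤ r⁻¹ := by
    have hn : ‖b‖ = 4 * π ^ 2 * ‖(ε + X.1 * I : ℂ)‖ := by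
      rw [hb, norm_mul]; simp
    have hpi : π * r ≤ 4 * π ^ 2 * ‖(ε + X.1 * I : ℂ)‖ := by
      have := Real.pi_gt_three
      have h4 : π ≤ 4 * π ^ 2 := by nlinarith
      exact mul_le_mul h4 hrb hr.le (by positivity)
    rw [norm_div, hn, norm_real, Real.norm_of_nonneg Real.pi_pos.le, inv_eq_one_div,
      div_le_div_iff₀ (mul_pos (by positivity) (hr.trans_le hrb)) hr, one_mul]
    exact hpi
  calc _ ≤ (r⁻¹) ^ (d / 2 : ℝ) * 1 := by gcongr
    _ = r ^ (-(d / 2 : ℝ)) := by rw [mul_one, Real.rpow_neg hr.le, Real.inv_rpow hr.le]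

theorem norm_bform_multiplier_le {ε : ℝ} (hε : 0 < ε) {κ : ℝ → ℂ} {k : ℝ → ℂ} {B : ℝ}
    (hκ : Integrable κ) (hκB : ∀ ω, ‖κ ω‖ ≤ B)
    (hk : ∀ t, k t = ∫ ω, κ ω * cexp ((2 * π * (ω * t) : ℝ) * I))
    {E F : ℝ × Rd d → ℂ}
    (hE : Integrable E) (hE2 : MemLp E 2) (hF : Integrable F) (hF2 : MemLp F 2)
    (hE1 : ∫⁻ X, ‖E X‖ₑ ^ 2 ≤ 1) (hF1 : ∫⁻ X, ‖F X‖ₑ ^ 2 ≤ 1) :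
    ‖bform (fun X => k X.1 * regKernel ε X) E F‖ ≤ B := by
  have hg := integrable_gaussian_rd (d := d) (c := 4 * π ^ 2 * ε) (by positivity)
  have ha : Integrable fun z : ℝ × Rd d =>
      κ z.1 * (Real.exp (-(4 * π ^ 2 * ε * ‖z.2‖ ^ 2)) : ℂ) := hκ.mul_prod hg.ofReal
  have hker : ∀ X : ℝ × Rd d, k X.1 * regKernel ε X = ∫ z : ℝ × Rd d,
      κ z.1 * (Real.exp (-(4 * π ^ 2 * ε * ‖z.2‖ ^ 2)) : ℂ) * pwave z X := by
    intro X
    rw [hk, regKernel, Measure.volume_eq_prod ℝ (Rd d), ← integral_prod_mul]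
    congr 1 with z
    have : pwave z X = cexp ((2 * π * (z.1 * X.1) : ℝ) * I) * pwave (0, z.2) X := by
      rw [pwave, wave, pwave, wave, ← Complex.exp_add, ← add_mul, ← ofReal_add]
      congr 3
      ring
    rw [this]; ring
  simp only [bform, hker]
  refine norm_integral_multiplier_le ha (fun z => ?_) hE hE2 hF hF2 hE1 hF1
  rw [norm_mul, norm_real, Real.norm_of_nonneg (Real.exp_nonneg _)]
  calc _ ≤ B * 1 := by
        refine mul_le_mul (hκB _) ?_ (Real.exp_nonneg _) ((norm_nonneg _).trans (hκB 0))
        rw [Real.exp_le_one_iff]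
        have : 0 ≤ 4 * π ^ 2 * ε * ‖z.2‖ ^ 2 := by positivity
        linarith
    _ = B := mul_one B

end Kernel

section HilbertSchmidt

theorem lintegral_enorm_sq_Lp {α : Type*} [MeasurableSpace α] {μ : Measure α} (f : Lp ℂ 2 μ) :
    ∫⁻ x, ‖f x‖ₑ ^ 2 ∂μ = ENNReal.ofReal (‖f‖ ^ 2) := by
  rw [← eLpNorm_two_sq, Lp.norm_def, ← ENNReal.toReal_pow, ENNReal.ofReal_toReal]
  exact ENNReal.pow_ne_top (Lp.eLpNorm_ne_top f)

theorem norm_sq_toLp_le {α : Type*} [MeasurableSpace α] {μ : Measure α} {f : α → ℂ}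
    (hf : MemLp f 2 μ) {A : ℝ} (hA : 0 ≤ A) (h : ∫⁻ x, ‖f x‖ₑ ^ 2 ∂μ ≤ ENNReal.ofReal A) :
    ‖hf.toLp f‖ ^ 2 ≤ A := by
  rw [← ENNReal.ofReal_le_ofReal_iff hA, ← lintegral_enorm_sq_Lp]
  refine le_trans (le_of_eq (lintegral_congr_ae ?_)) h
  filter_upwards [hf.coeFn_toLp] with x hx
  rw [hx]

variable {d : ℕ}

theorem integrable_bform {K E F : ℝ × Rd d → ℂ} (hK : Continuous K) {M : ℝ}
    (hM : ∀ X, ‖K X‖ ≤ M) (hE : Integrable E) (hF : Integrable F) :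
    Integrable fun p : (ℝ × Rd d) × (ℝ × Rd d) =>
      (starRingEnd ℂ) (E p.1) * K (p.1 - p.2) * F p.2 := by
  refine Integrable.mono (g := fun p : (ℝ × Rd d) × (ℝ × Rd d) => M * (‖E p.1‖ * ‖F p.2‖))
    ((hE.norm.mul_prod hF.norm).const_mul M) ?_ ?_
  · have h1 : AEStronglyMeasurable (fun p : (ℝ × Rd d) × (ℝ × Rd d) => E p.1)
      (volume.prod volume) := hE.1.comp_fst
    have h2 : AEStronglyMeasurable (fun p : (ℝ × Rd d) × (ℝ × Rd d) => F p.2)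
      (volume.prod volume) := hF.1.comp_snd
    exact ((Complex.continuous_conj.comp_aestronglyMeasurable h1).mul
      (hK.comp (by fun_prop : Continuous fun p : (ℝ × Rd d) × (ℝ × Rd d) =>
        p.1 - p.2)).aestronglyMeasurable).mul h2
  · refine Eventually.of_forall fun p => ?_
    have hM0 : 0 ≤ M := (norm_nonneg _).trans (hM 0)
    rw [norm_mul, norm_mul, RCLike.norm_conj, norm_mul, norm_mul, norm_norm, norm_norm,
      Real.norm_of_nonneg hM0]
    calc _ ≤ ‖E p.1‖ * M * ‖F p.2‖ := by gcongr; exact hM _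
      _ = _ := by ring

/-- Hilbert–Schmidt bound for `∑ cᵢ ⟨eᵢ, w₁ (K ∗ (w₂ eᵢ))⟩` over an orthonormal family. -/
theorem norm_sum_bform_le {ι : Type*} (s : Finset ι)
    {e : ι → Lp ℂ 2 (volume : Measure (ℝ × Rd d))} (he : Orthonormal ℂ e) (c : ι → ℂ)
    {K : ℝ × Rd d → ℂ} (hK : Continuous K) {M : ℝ} (hM : ∀ X, ‖K X‖ ≤ M)
    {w₁ w₂ : ℝ × Rd d → ℂ} (hw₁ : MemLp w₁ 2) (hw₂ : MemLp w₂ 2) {A : ℝ} (hA : 0 ≤ A)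
    (h₁ : ∫⁻ X, ‖w₁ X‖ₑ ^ 2 ≤ ENNReal.ofReal A) (h₂ : ∫⁻ X, ‖w₂ X‖ₑ ^ 2 ≤ ENNReal.ofReal A) :
    ‖∑ i ∈ s, c i * bform K (fun X => (starRingEnd ℂ) (w₁ X) * e i X)
      (fun X => w₂ X * e i X)‖ ≤ M * √(∑ i ∈ s, ‖c i‖ ^ 2) * A := by
  have hM0 : 0 ≤ M := (norm_nonneg _).trans (hM 0)
  have hw₁c : MemLp (fun X => (starRingEnd ℂ) (w₁ X)) 2 :=
    hw₁.norm.of_le_mul (c := 1) (Complex.continuous_conj.comp_aestronglyMeasurable hw₁.1)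
      (Eventually.of_forall fun X => by simp)
  have hE : ∀ i, Integrable fun X => (starRingEnd ℂ) (w₁ X) * e i X := fun i =>
    hw₁c.integrable_mul (Lp.memLp (e i))
  have hF : ∀ i, Integrable fun X => w₂ X * e i X := fun i => hw₂.integrable_mul (Lp.memLp (e i))
  have hh : ∀ X, MemLp (fun Y => (starRingEnd ℂ) (K (X - Y) * w₂ Y)) 2 := fun X =>
    hw₂.norm.of_le_mul (c := M)
      (Complex.continuous_conj.comp_aestronglyMeasurable
        ((hK.comp (by fun_prop : Continuous fun Y : ℝ × Rd d => X - Y)).aestronglyMeasurable.mul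
          hw₂.1))
      (Eventually.of_forall fun Y => by
        rw [RCLike.norm_conj, norm_mul, norm_norm]; gcongr; exact hM _)
  have hinner : ∀ X i, ∫ Y, K (X - Y) * (w₂ Y * e i Y) = ⟪(hh X).toLp _, e i⟫_ℂ := by
    intro X i
    rw [L2.inner_def]
    refine integral_congr_ae ?_
    filter_upwards [(hh X).coeFn_toLp] with Y hY
    rw [hY, RCLike.inner_apply, Complex.conj_conj]
    ring
  have hhn : ∀ X, ‖(hh X).toLp _‖ ^ 2 ≤ M ^ 2 * A := by
    intro X
    refine norm_sq_toLp_le (hh X) (by positivity) ?_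
    calc _ ≤ ∫⁻ Y, ENNReal.ofReal (M ^ 2) * ‖w₂ Y‖ₑ ^ 2 := by
          refine lintegral_mono fun Y => ?_
          rw [RCLike.enorm_conj, enorm_mul, mul_pow, ENNReal.ofReal_pow hM0]
          gcongr
          rw [← ofReal_norm]; exact ENNReal.ofReal_le_ofReal (hM _)
      _ ≤ _ := by
          rw [lintegral_const_mul' _ _ ENNReal.ofReal_ne_top, ENNReal.ofReal_mul (by positivity)]
          gcongr
  have hrep : ∀ i, bform K (fun X => (starRingEnd ℂ) (w₁ X) * e i X) (fun X => w₂ X * e i X)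
      = ∫ X, (w₁ X * (starRingEnd ℂ) (e i X)) * ⟪(hh X).toLp _, e i⟫_ℂ := by
    intro i
    have hint := integrable_bform hK hM (hE i) (hF i)
    rw [bform, Measure.volume_eq_prod (ℝ × Rd d), integral_prod _ hint]
    refine integral_congr_ae (Eventually.of_forall fun X => ?_)
    dsimp only
    rw [← hinner, ← integral_const_mul]
    congr 1 with Y
    simp only [map_mul, Complex.conj_conj]
    ring
  have hrepi : ∀ i, Integrable fun X =>
      c i * ((w₁ X * (starRingEnd ℂ) (e i X)) * ⟪(hh X).toLp _, e i⟫_ℂ) := by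
    intro i
    have hint : Integrable _ (volume.prod volume) := integrable_bform hK hM (hE i) (hF i)
    refine (hint.integral_prod_left.congr (Eventually.of_forall fun X => ?_)).const_mul _
    dsimp only
    rw [← hinner, ← integral_const_mul]
    congr 1 with Y
    simp only [map_mul, Complex.conj_conj]
    ring
  have hsum : ∑ i ∈ s, c i * bform K (fun X => (starRingEnd ℂ) (w₁ X) * e i X)
      (fun X => w₂ X * e i X) = ∫ X, ∑ i ∈ s,
        c i * ((w₁ X * (starRingEnd ℂ) (e i X)) * ⟪(hh X).toLp _, e i⟫_ℂ) := by
    rw [integral_finsetSum _ fun i _ => hrepi i]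
    refine Finset.sum_congr rfl fun i _ => ?_
    rw [hrep, integral_const_mul]
  set R : ℝ × Rd d → ℝ := fun X => √(∑ i ∈ s, (‖c i‖ * ‖e i X‖) ^ 2) with hR
  have hpt : ∀ X, ‖∑ i ∈ s, c i * ((w₁ X * (starRingEnd ℂ) (e i X)) * ⟪(hh X).toLp _, e i⟫_ℂ)‖
      ≤ (M * √A) * (‖w₁ X‖ * R X) := by
    intro X
    have hb : √(∑ i ∈ s, ‖⟪(hh X).toLp _, e i⟫_ℂ‖ ^ 2) ≤ M * √A := by
      refine Real.sqrt_le_iff.2 ⟨by positivity, ?_⟩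
      rw [mul_pow, Real.sq_sqrt hA]
      refine le_trans ?_ (hhn X)
      have := he.sum_inner_products_le ((hh X).toLp _) (s := s)
      simpa only [norm_inner_symm] using this
    calc _ ≤ ∑ i ∈ s, ‖w₁ X‖ * ((‖c i‖ * ‖e i X‖) * ‖⟪(hh X).toLp _, e i⟫_ℂ‖) := by
          refine (norm_sum_le _ _).trans (Finset.sum_le_sum fun i _ => le_of_eq ?_)
          simp only [norm_mul, RCLike.norm_conj]
          ring
      _ ≤ ‖w₁ X‖ * (R X * (M * √A)) := by
          rw [← Finset.mul_sum]
          gcongr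
          exact (Real.sum_mul_le_sqrt_mul_sqrt _ _ _).trans (by gcongr)
      _ = _ := by ring
  have hRm : AEMeasurable (fun X => ENNReal.ofReal (R X)) := by
    have : ∀ i, Measurable (e i : ℝ × Rd d → ℂ) := fun i => (Lp.stronglyMeasurable _).measurable
    fun_prop
  have hRint : ∫⁻ X, ENNReal.ofReal (R X) ^ (2 : ℝ) = ENNReal.ofReal (∑ i ∈ s, ‖c i‖ ^ 2) := by
    have : ∀ X, ENNReal.ofReal (R X) ^ (2 : ℝ)
        = ∑ i ∈ s, ENNReal.ofReal (‖c i‖ ^ 2) * ‖e i X‖ₑ ^ 2 := by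
      intro X
      rw [ENNReal.rpow_ofNat, ← ENNReal.ofReal_pow (Real.sqrt_nonneg _),
        Real.sq_sqrt (Finset.sum_nonneg fun i _ => sq_nonneg _),
        ENNReal.ofReal_sum_of_nonneg fun i _ => sq_nonneg _]
      refine Finset.sum_congr rfl fun i _ => ?_
      rw [mul_pow, ENNReal.ofReal_mul (sq_nonneg _), ENNReal.ofReal_pow (norm_nonneg (e i X)),
        ofReal_norm]
    simp_rw [this]
    rw [lintegral_finsetSum' _ fun i _ => by
      have : Measurable (e i : ℝ × Rd d → ℂ) := (Lp.stronglyMeasurable _).measurable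
      fun_prop, ENNReal.ofReal_sum_of_nonneg fun i _ => sq_nonneg _]
    refine Finset.sum_congr rfl fun i _ => ?_
    rw [lintegral_const_mul' _ _ ENNReal.ofReal_ne_top, lintegral_enorm_sq_Lp, he.1 i]
    simp
  have hCS := ENNReal.lintegral_mul_le_Lp_mul_Lq volume Real.HolderConjugate.two_two
    hw₁.1.enorm hRm
  rw [hRint] at hCS
  rw [hsum]
  rw [← ENNReal.ofReal_le_ofReal_iff (by positivity), ofReal_norm]
  calc _ ≤ ∫⁻ X, ENNReal.ofReal (M * √A) * (‖w₁ X‖ₑ * ENNReal.ofReal (R X)) := by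
        refine (enorm_integral_le_lintegral_enorm _).trans (lintegral_mono fun X => ?_)
        rw [← ofReal_norm, ← ofReal_norm, ← ENNReal.ofReal_mul (norm_nonneg _),
          ← ENNReal.ofReal_mul (by positivity)]
        exact ENNReal.ofReal_le_ofReal (hpt X)
    _ ≤ ENNReal.ofReal (M * √A) * (ENNReal.ofReal A ^ (1 / 2 : ℝ)
          * ENNReal.ofReal (∑ i ∈ s, ‖c i‖ ^ 2) ^ (1 / 2 : ℝ)) := by
        rw [lintegral_const_mul' _ _ ENNReal.ofReal_ne_top]
        gcongr
        refine hCS.trans ?_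
        gcongr
        simpa only [ENNReal.rpow_ofNat] using h₁
    _ = _ := by
        rw [ENNReal.ofReal_rpow_of_nonneg hA (by norm_num),
          ENNReal.ofReal_rpow_of_nonneg (Finset.sum_nonneg fun i _ => sq_nonneg _) (by norm_num),
          ← Real.sqrt_eq_rpow, ← Real.sqrt_eq_rpow, ← ENNReal.ofReal_mul (by positivity),
          ← ENNReal.ofReal_mul (by positivity)]
        congr 1
        linear_combination (M * √(∑ i ∈ s, ‖c i‖ ^ 2)) * Real.mul_self_sqrt hA

end HilbertSchmidt

section Dyadic

theorem exists_sum_min_zpow_le : ∃ C : ℝ, 0 < C ∧ ∀ (s : Finset ℤ) (x : ℝ), 0 ≤ x →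
    ∑ l ∈ s, min ((2 : ℝ) ^ l * x) ((2 : ℝ) ^ l * x)⁻¹ ≤ C := by
  set f : ℤ → ℝ := fun l => 2 * (1 / 2 : ℝ) ^ l.natAbs with hf
  have hfs : Summable f := by
    refine Summable.mul_left _ ?_
    refine Summable.of_nat_of_neg ?_ ?_ <;> simpa using summable_geometric_two
  have hf0 : ∀ l, 0 < f l := fun l => by positivity
  refine ⟨∑' l, f l, hfs.tsum_pos (fun l => (hf0 l).le) 0 (hf0 0), fun s x hx => ?_⟩
  rcases hx.eq_or_lt with rfl | hx
  · simpa using tsum_nonneg fun l => (hf0 l).le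
  obtain ⟨n, hn1, hn2⟩ := exists_mem_Ico_zpow hx (by norm_num : (1 : ℝ) < 2)
  have hle : ∀ l, min ((2 : ℝ) ^ l * x) ((2 : ℝ) ^ l * x)⁻¹ ≤ f (l + n) := by
    intro l
    have h2l : (0 : ℝ) < 2 ^ l := by positivity
    rcases le_or_gt 0 (l + n) with h | h
    · refine (min_le_right _ _).trans ?_
      have e : f (l + n) = 2 * ((2 : ℝ) ^ l * 2 ^ n)⁻¹ := by
        rw [← zpow_add₀ two_ne_zero, hf]
        obtain ⟨k, hk⟩ := Int.eq_ofNat_of_zero_le h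
        simp [hk]
      rw [e]
      have : ((2 : ℝ) ^ l * x)⁻¹ ≤ ((2 : ℝ) ^ l * 2 ^ n)⁻¹ := by gcongr
      have h0 : 0 < ((2 : ℝ) ^ l * 2 ^ n)⁻¹ := by positivity
      linarith
    · refine (min_le_left _ _).trans ?_
      have e : f (l + n) = (2 : ℝ) ^ l * 2 ^ (n + 1) := by
        rw [← zpow_add₀ two_ne_zero, ← add_assoc, zpow_add_one₀ two_ne_zero, hf, mul_comm]
        obtain ⟨k, hk⟩ := Int.eq_ofNat_of_zero_le (by omega : 0 ≤ -(l + n))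
        have hk' : l + n = -(k : ℤ) := by simpa using (by omega : l + n = -(k : ℤ))
        simp [hk']
      rw [e]
      gcongr
  calc _ ≤ ∑ l ∈ s, f (l + n) := Finset.sum_le_sum fun l _ => hle l
    _ ≤ ∑' l, f (l + n) :=
        Summable.sum_le_tsum _ (fun l _ => (hf0 _).le)
          ((Equiv.addRight n).summable_iff.2 hfs)
    _ = ∑' l, f l := (Equiv.addRight n).tsum_eq f

/-- A smooth cutoff `χ` together with its dyadic difference `φ = χ - χ(2 ·)`, whose Fourier
transform vanishes at the origin. -/
theorem exists_dyadic_profile : ∃ (χ : ℝ → ℝ) (φ : SchwartzMap ℝ ℂ) (C : ℝ),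
    Continuous χ ∧ (∀ x, |χ x| ≤ 1) ∧ (∀ x, |x| ≤ 1 → χ x = 1) ∧ (∀ x, 7 ≤ |x| → χ x = 0) ∧
    (∀ x, φ x = ((χ x - χ (2 * x) : ℝ) : ℂ)) ∧ 0 < C ∧
    ∀ ω, ‖𝓕 (φ : ℝ → ℂ) ω‖ ≤ C * min |ω| |ω|⁻¹ := by
  let β : ContDiffBump (0 : ℝ) := ⟨1, 2, one_pos, one_lt_two⟩
  set χ : ℝ → ℝ := fun x => β x - β (x - 5) with hχ
  have hχs : ContDiff ℝ ((⊤ : ℕ∞) : WithTop ℕ∞) χ :=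
    β.contDiff.sub (β.contDiff.comp (contDiff_id.sub contDiff_const))
  have hβ0 : ∀ x : ℝ, 2 ≤ |x| → β x = 0 := fun x hx =>
    β.zero_of_le_dist (by simpa [Real.dist_eq] using hx)
  have hβ1 : ∀ x : ℝ, |x| ≤ 1 → β x = 1 := fun x hx =>
    β.one_of_mem_closedBall (by simpa [Real.dist_eq] using hx)
  have hχ1 : ∀ x, |x| ≤ 1 → χ x = 1 := by
    intro x hx
    have := abs_le.1 hx
    have h5 : 2 ≤ |x - 5| := by rw [le_abs]; right; linarith
    simp [hχ, hβ1 x hx, hβ0 _ h5]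
  have hχ0 : ∀ x, 7 ≤ |x| → χ x = 0 := by
    intro x hx
    have h5 : 2 ≤ |x - 5| := by
      rcases le_abs.1 hx with h | h
      · exact le_abs.2 (Or.inl (by linarith))
      · exact le_abs.2 (Or.inr (by linarith))
    simp [hχ, hβ0 x (by linarith), hβ0 _ h5]
  have hχb : ∀ x, |χ x| ≤ 1 := by
    intro x
    rw [abs_le]
    have h1 := β.nonneg (x := x)
    have h2 := β.le_one (x := x)
    have h3 := β.nonneg (x := x - 5)
    have h4 := β.le_one (x := x - 5)
    simp only [hχ]
    constructor <;> linarith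
  have hχint : ∫ x, χ x = 0 := by
    have hi : Integrable (fun x => β x) := β.continuous.integrable_of_hasCompactSupport
      β.hasCompactSupport
    rw [hχ, integral_sub hi (hi.comp_sub_right 5), integral_sub_right_eq_self (fun x => β x) 5,
      sub_self]
  set g : ℝ → ℂ := fun x => ((χ x - χ (2 * x) : ℝ) : ℂ) with hg
  have hgs : ContDiff ℝ ((⊤ : ℕ∞) : WithTop ℕ∞) g :=
    Complex.ofRealCLM.contDiff.comp (hχs.sub (hχs.comp (contDiff_const.mul contDiff_id)))
  have hgc : HasCompactSupport g := by
    refine HasCompactSupport.intro (isCompact_closedBall (0 : ℝ) 7) fun x hx => ?_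
    rw [Metric.mem_closedBall, dist_zero_right, Real.norm_eq_abs, not_le] at hx
    have h2 : 7 ≤ |2 * x| := by rw [abs_mul, abs_two]; linarith
    simp [hg, hχ0 x hx.le, hχ0 _ h2]
  set φ : SchwartzMap ℝ ℂ := hgc.toSchwartzMap hgs with hφ
  have hφx : ∀ x, φ x = g x := fun x => rfl
  have hF0 : (𝓕 φ) 0 = 0 := by
    have hχi : Integrable χ := hχs.continuous.integrable_of_hasCompactSupport
      (HasCompactSupport.intro (isCompact_closedBall (0 : ℝ) 7) fun x hx => by
        rw [Metric.mem_closedBall, dist_zero_right, Real.norm_eq_abs, not_le] at hx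
        exact hχ0 x hx.le)
    rw [SchwartzMap.fourier_coe, Real.fourier_eq']
    simp only [inner_zero_right, mul_zero, ofReal_zero, zero_mul, Complex.exp_zero, one_smul, hφx,
      hg]
    rw [integral_complex_ofReal, integral_sub hχi (hχi.comp_mul_left' two_ne_zero),
      Measure.integral_comp_mul_left, hχint]
    simp
  obtain ⟨C1, hC1⟩ := (𝓕 φ).decay 1 0
  obtain ⟨C2, hC2⟩ := (𝓕 φ).decay 0 1
  refine ⟨χ, φ, max C1 C2, hχs.continuous, hχb, hχ1, hχ0, hφx, ?_, ?_⟩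
  · exact lt_max_of_lt_left hC1.1
  · intro ω
    rw [← SchwartzMap.fourier_coe]
    have hpos : 0 < max C1 C2 := lt_max_of_lt_left hC1.1
    rw [mul_min_of_nonneg _ _ hpos.le, le_min_iff]
    constructor
    · have hlip := Convex.norm_image_sub_le_of_norm_fderiv_le 
        (f := ((𝓕 φ : SchwartzMap ℝ ℂ) : ℝ → ℂ)) (s := Set.univ) (C := C2)
        (𝕜 := ℝ) (fun x _ => (𝓕 φ).differentiableAt) (fun x _ => by
          have := hC2.2 x
          rwa [pow_zero, one_mul, norm_iteratedFDeriv_one] at this) convex_univ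
          (Set.mem_univ 0) (Set.mem_univ ω)
      rw [hF0, sub_zero, sub_zero, Real.norm_eq_abs] at hlip
      exact hlip.trans (by gcongr; exact le_max_right _ _)
    · rcases eq_or_ne ω 0 with rfl | hω
      · simp [hF0]
      · have := hC1.2 ω
        rw [pow_one, norm_iteratedFDeriv_zero, Real.norm_eq_abs] at this
        rw [← div_eq_mul_inv, le_div_iff₀ (abs_pos.2 hω), mul_comm]
        exact this.trans (le_max_left _ _)

theorem sum_dyadic_eq {χ : ℝ → ℝ} (L : ℕ) (τ : ℝ) :
    ∑ l ∈ Finset.Ico (-(L : ℤ)) L, (χ ((2 : ℝ) ^ (-l) * τ) - χ (2 * ((2 : ℝ) ^ (-l) * τ)))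
      = χ ((2 : ℝ) ^ (-(L : ℤ) + 1) * τ) - χ ((2 : ℝ) ^ ((L : ℤ) + 1) * τ) := by
  have h : ∀ l : ℤ, 2 * ((2 : ℝ) ^ (-l) * τ) = (2 : ℝ) ^ (-l + 1) * τ := fun l => by
    rw [zpow_add_one₀ two_ne_zero]; ring
  simp_rw [h]
  induction L with
  | zero => simp
  | succ L ih =>
    have e : Finset.Ico (-((L + 1 : ℕ) : ℤ)) ((L + 1 : ℕ) : ℤ)
        = insert (-(L : ℤ) - 1) (insert (L : ℤ) (Finset.Ico (-(L : ℤ)) L)) := by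
      ext x
      simp only [Finset.mem_insert, Finset.mem_Ico]
      push_cast
      omega
    rw [e, Finset.sum_insert (by simp), Finset.sum_insert (by simp), ih]
    push_cast
    rw [show -(-(L : ℤ) - 1) = L + 1 by ring, show (-(L + 1) + 1 : ℤ) = -L by ring]
    ring

theorem exists_dyadic_kernel (D : ℝ) (hD : 0 ≤ D) :
    ∃ (χ : ℝ → ℝ) (φ : SchwartzMap ℝ ℂ) (C : ℝ),
    Continuous χ ∧ (∀ x, |χ x| ≤ 1) ∧ (∀ x, |x| ≤ 1 → χ x = 1) ∧ (∀ x, 7 ≤ |x| → χ x = 0) ∧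
    (∀ x, φ x = ((χ x - χ (2 * x) : ℝ) : ℂ)) ∧ 0 < C ∧
    (∀ (s : Finset ℤ) (c : ℤ → ℂ), (∀ l, ‖c l‖ ≤ 1) → ∃ κ : ℝ → ℂ, Integrable κ ∧
      (∀ ω, ‖κ ω‖ ≤ C) ∧ ∀ t, ∑ l ∈ s, c l * (((2 : ℝ) ^ (-l) : ℝ) : ℂ) * φ ((2 : ℝ) ^ (-l) * t)
        = ∫ ω, κ ω * cexp ((2 * π * (ω * t) : ℝ) * I)) ∧
    ∀ (s : Finset ℤ) (t : ℝ), ∑ l ∈ s, ((2 : ℝ) ^ l) ^ D * ‖φ ((2 : ℝ) ^ (-l) * t)‖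
      ≤ C * |t| ^ D := by
  obtain ⟨χ, φ, C, hχc, hχb, hχ1, hχ0, hφ, hC, hφC⟩ := exists_dyadic_profile
  obtain ⟨C', hC', hmin⟩ := exists_sum_min_zpow_le
  refine ⟨χ, φ, max (C * C') (2 * 2 ^ D * 7 * C'), hχc, hχb, hχ1, hχ0, hφ,
    lt_max_of_lt_left (by positivity), ?_, ?_⟩
  · intro s c hc
    have hint : Integrable (𝓕 (φ : ℝ → ℂ)) := by
      rw [← SchwartzMap.fourier_coe]; exact (𝓕 φ).integrable
    refine ⟨fun ω => ∑ l ∈ s, c l * 𝓕 (φ : ℝ → ℂ) ((2 : ℝ) ^ l * ω), ?_, fun ω => ?_, fun t => ?_⟩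
    · exact integrable_finsetSum _ fun l _ =>
        (hint.comp_mul_left' (by positivity)).const_mul _
    · refine le_max_of_le_left ?_
      calc _ ≤ ∑ l ∈ s, C * min ((2 : ℝ) ^ l * |ω|) ((2 : ℝ) ^ l * |ω|)⁻¹ := by
            refine (norm_sum_le _ _).trans (Finset.sum_le_sum fun l _ => ?_)
            rw [norm_mul]
            have := hφC ((2 : ℝ) ^ l * ω)
            rw [abs_mul, abs_of_pos (by positivity : (0 : ℝ) < 2 ^ l)] at this
            calc _ ≤ 1 * ‖𝓕 (φ : ℝ → ℂ) ((2 : ℝ) ^ l * ω)‖ := by gcongr; exact hc l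
              _ ≤ _ := by rwa [one_mul]
        _ ≤ C * C' := by rw [← Finset.mul_sum]; gcongr; exact hmin s _ (abs_nonneg _)
    · simp_rw [Finset.sum_mul]
      have hexp : ∀ l : ℤ, Integrable fun ω : ℝ => c l * 𝓕 (φ : ℝ → ℂ) ((2 : ℝ) ^ l * ω)
          * cexp ((2 * π * (ω * t) : ℝ) * I) := fun l => by
        refine ((hint.comp_mul_left' (by positivity)).const_mul _).mul_bdd (c := 1)
          (by fun_prop) (Eventually.of_forall fun ω => (norm_exp_ofReal_mul_I _).le)
      rw [integral_finsetSum _ fun l _ => hexp l]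
      refine Finset.sum_congr rfl fun l _ => ?_
      have hinv : φ ((2 : ℝ) ^ (-l) * t) = ∫ η : ℝ, 𝓕 (φ : ℝ → ℂ) η
          * cexp ((2 * π * (η * ((2 : ℝ) ^ (-l) * t)) : ℝ) * I) := by
        have h := congrFun (φ.continuous.fourierInv_fourier_eq φ.integrable hint)
          ((2 : ℝ) ^ (-l) * t)
        rw [← h, Real.fourierInv_eq']
        congr 1 with η
        rw [smul_eq_mul, mul_comm]
        congr 3
        simp
        ring
      have h2l : (0 : ℝ) < 2 ^ l := by positivity
      have hcv := Measure.integral_comp_mul_left (fun η : ℝ => 𝓕 (φ : ℝ → ℂ) η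
          * cexp ((2 * π * (η * ((2 : ℝ) ^ (-l) * t)) : ℝ) * I)) ((2 : ℝ) ^ l)
      rw [← hinv, abs_of_pos (by positivity), ← zpow_neg, Complex.real_smul] at hcv
      rw [mul_assoc, ← hcv, ← integral_const_mul]
      congr 1 with ω
      rw [← mul_assoc]
      congr 4
      rw [zpow_neg]
      field_simp
  · intro s t
    rcases eq_or_ne t 0 with rfl | ht
    · have : φ 0 = 0 := by simp [hφ]
      simp only [mul_zero, this, norm_zero, Finset.sum_const_zero]
      positivity
    have htp : 0 < |t| := abs_pos.2 ht
    have hterm : ∀ l : ℤ, ((2 : ℝ) ^ l) ^ D * ‖φ ((2 : ℝ) ^ (-l) * t)‖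
        ≤ (2 * 2 ^ D * 7 * |t| ^ D) * min ((2 : ℝ) ^ (-l) * |t|) ((2 : ℝ) ^ (-l) * |t|)⁻¹ := by
      intro l
      set σ := (2 : ℝ) ^ (-l) * t with hσ
      have h2l : (0 : ℝ) < 2 ^ l := by positivity
      have hσa : |σ| = (2 : ℝ) ^ (-l) * |t| := by
        rw [hσ, abs_mul, abs_of_pos (by positivity)]
      have hσp : 0 < |σ| := by rw [hσa]; positivity
      have hte : (2 : ℝ) ^ l = |t| * |σ|⁻¹ := by
        rw [hσa, zpow_neg]; field_simp
      rw [← hσa]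
      by_cases hz : φ σ = 0
      · rw [hz, norm_zero, mul_zero]; positivity
      have h1 : 1 / 2 ≤ |σ| := by
        by_contra! h
        refine hz ?_
        rw [hφ, hχ1 _ (by linarith), hχ1 _ (by rw [abs_mul, abs_two]; linarith)]
        simp
      have h2 : |σ| ≤ 7 := by
        by_contra! h
        refine hz ?_
        rw [hφ, hχ0 _ h.le, hχ0 _ (by rw [abs_mul, abs_two]; linarith)]
        simp
      have h3 : ‖φ σ‖ ≤ 2 := by
        rw [hφ, norm_real, Real.norm_eq_abs]
        have := abs_sub (χ σ) (χ (2 * σ))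
        have := hχb σ
        have := hχb (2 * σ)
        linarith
      have h4 : 1 ≤ 7 * min |σ| |σ|⁻¹ := by
        rw [mul_min_of_nonneg _ _ (by norm_num), le_min_iff]
        constructor
        · linarith
        · rw [← div_eq_mul_inv, le_div_iff₀ hσp]; linarith
      have h5 : |σ|⁻¹ ≤ 2 := by
        rw [inv_le_comm₀ hσp two_pos]; linarith
      have h6 : ((2 : ℝ) ^ l) ^ D ≤ |t| ^ D * 2 ^ D := by
        rw [hte, Real.mul_rpow (by positivity) (by positivity)]
        gcongr
      calc _ ≤ (|t| ^ D * 2 ^ D) * 2 * 1 := by rw [mul_one]; gcongr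
        _ ≤ (|t| ^ D * 2 ^ D) * 2 * (7 * min |σ| |σ|⁻¹) := by gcongr
        _ = _ := by ring
    calc _ ≤ ∑ l ∈ s, (2 * 2 ^ D * 7 * |t| ^ D)
              * min ((2 : ℝ) ^ (-l) * |t|) ((2 : ℝ) ^ (-l) * |t|)⁻¹ :=
          Finset.sum_le_sum fun l _ => hterm l
      _ ≤ (2 * 2 ^ D * 7 * |t| ^ D) * C' := by
          rw [← Finset.mul_sum]
          gcongr
          have := hmin (s.map (Equiv.neg ℤ).toEmbedding) |t| htp.le
          simpa using this
      _ = (2 * 2 ^ D * 7 * C') * |t| ^ D := by ring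
      _ ≤ _ := by gcongr; exact le_max_right _ _

end Dyadic

section Interpolation

/-- Entire functions bounded on the strip `0 ≤ re z ≤ 1`. -/
def StripBounded (f : ℂ → ℂ) : Prop :=
  Differentiable ℂ f ∧ ∃ C : ℝ, ∀ z : ℂ, 0 ≤ z.re → z.re ≤ 1 → ‖f z‖ ≤ C

namespace StripBounded

theorem const (c : ℂ) : StripBounded fun _ => c :=
  ⟨differentiable_const c, ‖c‖, fun _ _ _ => le_rfl⟩

theorem mul {f g : ℂ → ℂ} (hf : StripBounded f) (hg : StripBounded g) :
    StripBounded fun z => f z * g z := by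
  obtain ⟨hf, C, hC⟩ := hf
  obtain ⟨hg, D, hD⟩ := hg
  refine ⟨hf.mul hg, C * D, fun z h0 h1 => ?_⟩
  rw [norm_mul]
  exact mul_le_mul (hC z h0 h1) (hD z h0 h1) (norm_nonneg _) ((norm_nonneg _).trans (hC z h0 h1))

theorem sum {ι : Type*} (s : Finset ι) {f : ι → ℂ → ℂ} (hf : ∀ i ∈ s, StripBounded (f i)) :
    StripBounded fun z => ∑ i ∈ s, f i z := by
  classical
  induction s using Finset.induction_on with
  | empty => simpa using const 0
  | insert i s hi ih =>
    obtain ⟨h1, C, hC⟩ := hf i (Finset.mem_insert_self _ _)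
    obtain ⟨h2, D, hD⟩ := ih fun j hj => hf j (Finset.mem_insert_of_mem hj)
    simp only [Finset.sum_insert hi]
    exact ⟨h1.add h2, C + D, fun z h0 h1 =>
      (norm_add_le _ _).trans (add_le_add (hC z h0 h1) (hD z h0 h1))⟩

theorem cexp_affine (a b c : ℝ) : StripBounded fun z => cexp ((a + b * z) * c) := by
  refine ⟨by fun_prop, Real.exp ((|a| + |b|) * |c|), fun z h0 h1 => ?_⟩
  rw [Complex.norm_exp, Real.exp_le_exp]
  have : ((a + b * z) * c : ℂ).re = (a + b * z.re) * c := by simp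
  rw [this]
  refine (le_abs_self _).trans ?_
  rw [abs_mul]
  gcongr
  refine (abs_add_le _ _).trans ?_
  rw [abs_mul, abs_of_nonneg h0]
  nlinarith [abs_nonneg b]

end StripBounded

/-- The complex power `W ^ ζ` of a simple function, set to `0` where `W` vanishes. -/
def simplePow {X : Type*} [MeasurableSpace X] (W : SimpleFunc X ℝ) (ζ : ℂ) : SimpleFunc X ℂ :=
  W.map fun a => if a = 0 then 0 else cexp (ζ * Real.log a)

section SimplePow

variable {X : Type*} [MeasurableSpace X] {μ : Measure X} {W : SimpleFunc X ℝ}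

theorem simplePow_memLp (hWf : W.FinMeasSupp μ) (ζ : ℂ) (p : ℝ≥0∞) :
    MemLp (simplePow W ζ) p μ := by
  have h : (simplePow W ζ).FinMeasSupp μ := SimpleFunc.FinMeasSupp.map hWf (by simp)
  exact SimpleFunc.memLp_of_finite_measure_preimage p (SimpleFunc.finMeasSupp_iff.1 h)

theorem simplePow_apply (ζ : ℂ) (x : X) :
    simplePow W ζ x = if W x = 0 then 0 else cexp (ζ * Real.log (W x)) := rfl

theorem simplePow_one (hW : ∀ x, 0 ≤ W x) (x : X) : simplePow W 1 x = W x := by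
  rw [simplePow_apply]
  split_ifs with h
  · simp [h]
  · rw [one_mul, ← ofReal_exp, Real.exp_log ((hW x).lt_of_ne' h)]

theorem norm_simplePow_le (hW : ∀ x, 0 ≤ W x) (ζ : ℂ) (x : X) :
    ‖simplePow W ζ x‖ ≤ W x ^ ζ.re := by
  rw [simplePow_apply]
  split_ifs with h
  · rw [norm_zero]; exact Real.rpow_nonneg (hW x) _
  · rw [Complex.norm_exp, re_mul_ofReal, Real.rpow_def_of_pos ((hW x).lt_of_ne' h), mul_comm]

theorem simplePow_eq_sum (ζ : ℂ) (x : X) : simplePow W ζ x =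
    ∑ a ∈ W.range, cexp (ζ * Real.log a) * (if W x = a ∧ a ≠ 0 then 1 else 0) := by
  rw [Finset.sum_eq_single (W x)]
  · rw [simplePow_apply]; split_ifs <;> simp_all
  · intro b _ hb
    rw [if_neg fun h => hb h.1.symm, mul_zero]
  · intro h; exact absurd (SimpleFunc.mem_range_self W x) h

end SimplePow

variable {d : ℕ}

theorem bform_sum_left {ι : Type*} (s : Finset ι) (c : ι → ℂ) {K : ι → ℝ × Rd d → ℂ}
    {E F : ℝ × Rd d → ℂ} (hK : ∀ i, Continuous (K i)) (hM : ∀ i, ∃ M, ∀ X, ‖K i X‖ ≤ M)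
    (hE : Integrable E) (hF : Integrable F) :
    bform (fun X => ∑ i ∈ s, c i * K i X) E F = ∑ i ∈ s, c i * bform (K i) E F := by
  simp only [bform]
  have h : ∀ i, Integrable fun p : (ℝ × Rd d) × (ℝ × Rd d) =>
      c i * ((starRingEnd ℂ) (E p.1) * K i (p.1 - p.2) * F p.2) := fun i => by
    obtain ⟨M, hM⟩ := hM i
    exact (integrable_bform (hK i) hM hE hF).const_mul _
  simp_rw [← integral_const_mul]
  rw [← integral_finsetSum _ fun i _ => h i]
  congr 1 with p
  rw [Finset.mul_sum, Finset.sum_mul]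
  exact Finset.sum_congr rfl fun i _ => by ring

theorem stripBounded_bform {K : ℝ × Rd d → ℂ} (hK : Continuous K) {M : ℝ}
    (hM : ∀ X, ‖K X‖ ≤ M) {f : ℝ × Rd d → ℂ} (hf : MemLp f 2)
    {W : SimpleFunc (ℝ × Rd d) ℝ} (hWf : W.FinMeasSupp volume) (r : ℝ) :
    StripBounded fun z => bform K (fun X => (starRingEnd ℂ) (simplePow W (r * z) X) * f X)
      (fun X => simplePow W (r * z) X * f X) := by
  set ind : ℝ → ℝ × Rd d → ℂ := fun a X => if W X = a ∧ a ≠ 0 then 1 else 0 with hind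
  have hindm : ∀ a, MemLp (ind a) 2 := fun a => by
    have h := (simplePow_memLp hWf 0 2).norm
    refine h.of_le ?_ (Eventually.of_forall fun X => ?_)
    · refine Measurable.aestronglyMeasurable (Measurable.ite ?_ measurable_const measurable_const)
      exact (W.measurableSet_fiber a).inter (MeasurableSet.const _)
    · simp only [hind, simplePow_apply]
      by_cases h : W X = a ∧ a ≠ 0
      · simp [h]
      · simp [h]
  have hi : ∀ a, Integrable fun X => ind a X * f X := fun a => (hindm a).integrable_mul hf
  have hrep : ∀ z : ℂ, bform K (fun X => (starRingEnd ℂ) (simplePow W (r * z) X) * f X)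
      (fun X => simplePow W (r * z) X * f X) = ∑ a ∈ W.range, ∑ b ∈ W.range,
        (cexp ((0 + r * z) * Real.log a) * cexp ((0 + r * z) * Real.log b))
          * bform K (fun X => ind a X * f X) (fun X => ind b X * f X) := by
    intro z
    simp only [bform]
    simp_rw [← integral_const_mul]
    have h : ∀ a b, Integrable fun p : (ℝ × Rd d) × (ℝ × Rd d) =>
        (cexp ((0 + r * z) * Real.log a) * cexp ((0 + r * z) * Real.log b)) *
        ((starRingEnd ℂ) (ind a p.1 * f p.1) * K (p.1 - p.2) * (ind b p.2 * f p.2)) := fun a b =>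
      (integrable_bform hK hM (hi a) (hi b)).const_mul _
    simp_rw [← integral_finsetSum _ fun b _ => h _ b]
    rw [← integral_finsetSum _ fun a _ => integrable_finsetSum _ fun b _ => h a b]
    congr 1 with p
    simp only [map_mul, Complex.conj_conj]
    rw [simplePow_eq_sum (r * z : ℂ) p.1, simplePow_eq_sum (r * z : ℂ) p.2]
    have hconj : ∀ a, (starRingEnd ℂ) (ind a p.1) = ind a p.1 := fun a => by
      simp only [hind]; split_ifs <;> simp
    simp_rw [hconj, zero_add]
    rw [Finset.sum_mul, Finset.sum_mul, Finset.sum_mul]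
    refine Finset.sum_congr rfl fun a _ => ?_
    rw [Finset.sum_mul, Finset.mul_sum]
    refine Finset.sum_congr rfl fun b _ => ?_
    simp only [hind]
    ring
  simp only [hrep]
  refine StripBounded.sum _ fun a _ => StripBounded.sum _ fun b _ => ?_
  have h1 := StripBounded.cexp_affine 0 r (Real.log a)
  have h2 := StripBounded.cexp_affine 0 r (Real.log b)
  simp only [ofReal_zero] at h1 h2
  exact (h1.mul h2).mul (StripBounded.const _)

end Interpolation

section Schatten

variable {d : ℕ}

theorem simplePow_mul_conditions {X : Type*} [MeasurableSpace X] {μ : Measure X}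
    {W : SimpleFunc X ℝ} (hW : ∀ x, 0 ≤ W x) (hWf : W.FinMeasSupp μ) {ζ : ℂ} (hζ : ζ.re = 0)
    {f : Lp ℂ 2 μ} (hf : ‖f‖ = 1) {w : X → ℂ} (hw : ∀ x, ‖w x‖ = ‖simplePow W ζ x‖)
    (hwm : AEStronglyMeasurable w μ) :
    Integrable (fun x => w x * f x) μ ∧ MemLp (fun x => w x * f x) 2 μ ∧
      ∫⁻ x, ‖w x * f x‖ₑ ^ 2 ∂μ ≤ 1 := by
  have hw1 : ∀ x, ‖w x‖ ≤ 1 := fun x => by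
    rw [hw]
    refine (norm_simplePow_le hW ζ x).trans ?_
    rw [hζ, Real.rpow_zero]
  refine ⟨?_, ?_, ?_⟩
  · have : MemLp w 2 μ :=
      (simplePow_memLp hWf ζ 2).of_le hwm (Eventually.of_forall fun x => (hw x).le)
    exact this.integrable_mul (Lp.memLp f)
  · refine (Lp.memLp f).of_le (hwm.mul (Lp.memLp f).1) (Eventually.of_forall fun x => ?_)
    rw [norm_mul]
    exact mul_le_of_le_one_left (norm_nonneg _) (hw1 x)
  · calc _ ≤ ∫⁻ x, ‖f x‖ₑ ^ 2 ∂μ := by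
          refine lintegral_mono fun x => ?_
          gcongr
          rw [enorm_mul, ← one_mul ‖f x‖ₑ]
          gcongr
          · rw [← ofReal_norm, ← ENNReal.ofReal_one]; exact ENNReal.ofReal_le_ofReal (hw1 x)
          · rw [one_mul]
      _ = 1 := by rw [lintegral_enorm_sq_Lp, hf]; simp

theorem norm_sum_dyadic_bform_le {φ : ℝ → ℂ} (hφc : Continuous φ) (hφ0 : φ 0 = 0)
    (hφb : ∀ x, ‖φ x‖ ≤ 2) {C : ℝ} (hC : 0 < C)
    (hA : ∀ (s : Finset ℤ) (c : ℤ → ℂ), (∀ l, ‖c l‖ ≤ 1) → ∃ κ : ℝ → ℂ, Integrable κ ∧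
      (∀ ω, ‖κ ω‖ ≤ C) ∧ ∀ t, ∑ l ∈ s, c l * (((2 : ℝ) ^ (-l) : ℝ) : ℂ) * φ ((2 : ℝ) ^ (-l) * t)
        = ∫ ω, κ ω * cexp ((2 * π * (ω * t) : ℝ) * I))
    (hB : ∀ (s : Finset ℤ) (t : ℝ), ∑ l ∈ s, ((2 : ℝ) ^ l) ^ (d / 2 : ℝ)
      * ‖φ ((2 : ℝ) ^ (-l) * t)‖ ≤ C * |t| ^ (d / 2 : ℝ))
    {ε : ℝ} (hε : 0 < ε) {ι : Type*} (s : Finset ι)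
    {e : ι → Lp ℂ 2 (volume : Measure (ℝ × Rd d))} (he : Orthonormal ℂ e) {μ : ι → ℝ}
    (hμ : ∀ i ∈ s, 0 < μ i) {W : SimpleFunc (ℝ × Rd d) ℝ} (hW : ∀ X, 0 ≤ W X)
    (hWf : W.FinMeasSupp volume) {A : ℝ} (hA0 : 0 ≤ A)
    (hWA : ∫⁻ X, ENNReal.ofReal (W X ^ (d + 2 : ℝ)) ≤ ENNReal.ofReal A) (Λ : Finset ℤ) :
    ‖∑ i ∈ s, (μ i : ℂ) * bform
        (fun X => (∑ l ∈ Λ, φ ((2 : ℝ) ^ (-l) * X.1)) * regKernel ε X)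
        (fun X => (W X : ℂ) * e i X) (fun X => (W X : ℂ) * e i X)‖
      ≤ C * (∑ i ∈ s, μ i ^ ((d + 2 : ℝ) / (d + 1))) ^ ((d + 1 : ℝ) / (d + 2))
        * A ^ (2 / (d + 2 : ℝ)) := by
  set m : ℝ := d + 2 with hm
  have hm2 : 2 ≤ m := by rw [hm]; have : (0 : ℝ) ≤ d := Nat.cast_nonneg d; linarith
  have hm0 : 0 < m := by linarith
  have hd1 : (0 : ℝ) < d + 1 := by positivity
  set α : ℝ := m / (d + 1) with hα
  set S : ℝ := ∑ i ∈ s, μ i ^ α with hS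
  have hS0 : 0 ≤ S := Finset.sum_nonneg fun i hi => Real.rpow_nonneg (hμ i hi).le _
  set K : ℤ → ℝ × Rd d → ℂ := fun l X => φ ((2 : ℝ) ^ (-l) * X.1) * regKernel ε X with hKdef
  have hKc : ∀ l, Continuous (K l) := fun l =>
    (hφc.comp (by fun_prop : Continuous fun X : ℝ × Rd d => (2 : ℝ) ^ (-l) * X.1)).mul
      (continuous_regKernel hε)
  have hKb : ∀ l X, ‖K l X‖ ≤ 2 * ε ^ (-(d / 2 : ℝ)) := fun l X => by
    rw [hKdef, norm_mul]
    exact mul_le_mul (hφb _) (norm_regKernel_le hε X hε (Or.inl le_rfl)) (norm_nonneg _)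
      (by norm_num)
  set γ : ℂ → ℤ → ℂ := fun z l => cexp (((-1 : ℝ) + (m / 2 : ℝ) * z) * (l * Real.log 2 : ℝ)) with hγ
  set η : ℂ → ι → ℂ := fun z i => cexp ((α + (-(α / 2) : ℝ) * z) * Real.log (μ i)) with hη
  set w : ℂ → ℝ × Rd d → ℂ := fun z X => simplePow W ((m / 2 : ℝ) * z) X with hw
  have hwL2 : ∀ z, MemLp (w z) 2 := fun z => simplePow_memLp hWf _ _
  have hconjm : ∀ z, AEStronglyMeasurable (fun X => (starRingEnd ℂ) (w z X)) volume := fun z =>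
    Complex.continuous_conj.comp_aestronglyMeasurable (hwL2 z).1
  have hconj2 : ∀ z, MemLp (fun X => (starRingEnd ℂ) (w z X)) 2 := fun z =>
    (hwL2 z).of_le (hconjm z) (Eventually.of_forall fun X => by simp)
  have hEi : ∀ z i, Integrable fun X => (starRingEnd ℂ) (w z X) * e i X := fun z i =>
    (hconj2 z).integrable_mul (Lp.memLp (e i))
  have hFi : ∀ z i, Integrable fun X => w z X * e i X := fun z i =>
    (hwL2 z).integrable_mul (Lp.memLp (e i))
  set Φ : ℂ → ℂ := fun z => ∑ i ∈ s, η z i * ∑ l ∈ Λ, γ z l * bform (K l)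
    (fun X => (starRingEnd ℂ) (w z X) * e i X) (fun X => w z X * e i X) with hΦ
  have hΦ' : ∀ z, Φ z = ∑ i ∈ s, η z i * bform (fun X => ∑ l ∈ Λ, γ z l * K l X)
    (fun X => (starRingEnd ℂ) (w z X) * e i X) (fun X => w z X * e i X) := fun z => by
    simp only [hΦ]
    refine Finset.sum_congr rfl fun i _ => ?_
    rw [bform_sum_left Λ (γ z) hKc (fun l => ⟨_, hKb l⟩) (hEi z i) (hFi z i)]
  have hstrip : StripBounded Φ := by
    refine StripBounded.sum _ fun i _ => StripBounded.mul ?_ (StripBounded.sum _ fun l _ =>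
      StripBounded.mul ?_ ?_)
    · exact StripBounded.cexp_affine _ _ _
    · exact StripBounded.cexp_affine _ _ _
    · exact stripBounded_bform (hKc l) (hKb l) (Lp.memLp (e i)) hWf _
  have hηn : ∀ z, ∀ i ∈ s, ‖η z i‖ = μ i ^ (α - α / 2 * z.re) := fun z i hi => by
    rw [hη, Complex.norm_exp, Real.rpow_def_of_pos (hμ i hi)]
    congr 1
    simp
    ring
  have hγn : ∀ z l, ‖γ z l‖ = ((2 : ℝ) ^ l) ^ (-1 + m / 2 * z.re) := fun z l => by
    rw [hγ, Complex.norm_exp, ← Real.rpow_intCast, ← Real.rpow_mul (by norm_num),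
      Real.rpow_def_of_pos two_pos, re_mul_ofReal, add_re, ofReal_re, re_ofReal_mul]
    congr 1
    ring
  have h0 : ∀ z ∈ re ⁻¹' {0}, ‖Φ z‖ ≤ C * S := by
    intro z hz
    have hz : z.re = 0 := hz
    have hbf : ∀ i, ‖bform (fun X => ∑ l ∈ Λ, γ z l * K l X)
        (fun X => (starRingEnd ℂ) (w z X) * e i X) (fun X => w z X * e i X)‖ ≤ C := by
      intro i
      obtain ⟨κ, hκ1, hκ2, hκ3⟩ := hA Λ (fun l => γ z l * ((2 : ℝ) ^ l : ℝ)) fun l => by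
        rw [norm_mul, hγn, hz, mul_zero, add_zero, norm_real, Real.norm_of_nonneg (by positivity),
          Real.rpow_neg_one, inv_mul_cancel₀ (by positivity)]
      have hre : ((m / 2 : ℝ) * z : ℂ).re = 0 := by rw [re_ofReal_mul, hz, mul_zero]
      have c1 := simplePow_mul_conditions hW hWf hre (he.1 i)
        (w := fun X => (starRingEnd ℂ) (w z X)) (fun X => by simp [hw]) (hconjm z)
      have c2 := simplePow_mul_conditions hW hWf hre (he.1 i) (w := w z) (fun X => rfl) (hwL2 z).1
      have := norm_bform_multiplier_le hε hκ1 hκ2 hκ3 c1.1 c1.2.1 c2.1 c2.2.1 c1.2.2 c2.2.2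
      convert this using 4 with X
      rw [Finset.sum_mul]
      refine Finset.sum_congr rfl fun l _ => ?_
      simp only [hKdef]
      have : ((2 : ℝ) ^ l : ℝ) * ((2 : ℝ) ^ (-l)) = 1 := by
        rw [← zpow_add₀ two_ne_zero, add_neg_cancel, zpow_zero]
      have h2 : (((2 : ℝ) ^ l : ℝ) : ℂ) * (((2 : ℝ) ^ (-l) : ℝ) : ℂ) = 1 := by
        rw [← ofReal_mul, this, ofReal_one]
      linear_combination (-(γ z l) * φ ((2 : ℝ) ^ (-l) * X.1) * regKernel ε X) * h2
    rw [hΦ']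
    calc _ ≤ ∑ i ∈ s, μ i ^ α * C := by
          refine (norm_sum_le _ _).trans (Finset.sum_le_sum fun i hi => ?_)
          rw [norm_mul, hηn z i hi, hz, mul_zero, sub_zero]
          gcongr
          · exact Real.rpow_nonneg (hμ i hi).le _
          · exact hbf i
      _ = C * S := by rw [← Finset.sum_mul, mul_comm]
  have h1 : ∀ z ∈ re ⁻¹' {1}, ‖Φ z‖ ≤ C * √S * A := by
    intro z hz
    have hz : z.re = 1 := hz
    have hKz : Continuous fun X => ∑ l ∈ Λ, γ z l * K l X :=
      continuous_finsetSum _ fun l _ => continuous_const.mul (hKc l)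
    have hKzb : ∀ X : ℝ × Rd d, ‖∑ l ∈ Λ, γ z l * K l X‖ ≤ C := by
      intro X
      rcases eq_or_ne X.1 0 with ht | ht
      · simp [hKdef, ht, hφ0, hC.le]
      have htp : 0 < |X.1| := abs_pos.2 ht
      calc _ ≤ ∑ l ∈ Λ, (((2 : ℝ) ^ l) ^ (d / 2 : ℝ) * ‖φ ((2 : ℝ) ^ (-l) * X.1)‖)
              * |X.1| ^ (-(d / 2 : ℝ)) := by
            refine (norm_sum_le _ _).trans (Finset.sum_le_sum fun l _ => ?_)
            rw [norm_mul, hγn, hz, hKdef, norm_mul, ← mul_assoc]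
            have : -1 + m / 2 * 1 = (d / 2 : ℝ) := by rw [hm]; ring
            rw [this]
            gcongr
            exact norm_regKernel_le hε X htp (Or.inr le_rfl)
        _ ≤ C * |X.1| ^ (d / 2 : ℝ) * |X.1| ^ (-(d / 2 : ℝ)) := by
            rw [← Finset.sum_mul]; gcongr; exact hB Λ X.1
        _ = C := by
            rw [mul_assoc, ← Real.rpow_add htp, add_neg_cancel, Real.rpow_zero, mul_one]
    have hwA : ∫⁻ X, ‖w z X‖ₑ ^ 2 ≤ ENNReal.ofReal A := by
      refine le_trans (lintegral_mono fun X => ?_) hWA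
      rw [← ofReal_norm, ← ENNReal.ofReal_pow (norm_nonneg _)]
      refine ENNReal.ofReal_le_ofReal ?_
      have h := norm_simplePow_le hW ((m / 2 : ℝ) * z) X
      rw [re_ofReal_mul, hz, mul_one] at h
      calc _ ≤ (W X ^ (m / 2)) ^ 2 := by gcongr
        _ = W X ^ m := by
          rw [← Real.rpow_natCast, ← Real.rpow_mul (hW X)]; congr 1; push_cast; ring
    have := norm_sum_bform_le s he (η z) hKz hKzb (hwL2 z) (hwL2 z) hA0 hwA hwA
    rw [hΦ']
    refine this.trans (le_of_eq ?_)
    congr 3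
    refine Finset.sum_congr rfl fun i hi => ?_
    rw [hηn z i hi, hz, ← Real.rpow_natCast, ← Real.rpow_mul (hμ i hi).le]
    congr 1
    push_cast; ring
  set θ : ℝ := 2 / m with hθ
  have hθ0 : 0 < θ := by positivity
  have hθ1 : θ ≤ 1 := by rw [hθ, div_le_one hm0]; exact hm2
  obtain ⟨hdiff, C₁, hC₁⟩ := hstrip
  have key := Complex.HadamardThreeLines.norm_le_interp_of_mem_verticalClosedStrip₀₁' Φ
    (z := (θ : ℂ)) (by simp [Complex.HadamardThreeLines.verticalClosedStrip, hθ0.le, hθ1])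
    hdiff.diffContOnCl
    ⟨C₁, by rintro _ ⟨z, hz, rfl⟩; exact hC₁ z hz.1 hz.2⟩ h0 h1
  have hval : Φ θ = ∑ i ∈ s, (μ i : ℂ) * bform
        (fun X => (∑ l ∈ Λ, φ ((2 : ℝ) ^ (-l) * X.1)) * regKernel ε X)
        (fun X => (W X : ℂ) * e i X) (fun X => (W X : ℂ) * e i X) := by
    have hmθ : m / 2 * θ = 1 := by rw [hθ]; field_simp
    have hw1 : ∀ X, w θ X = W X := fun X => by
      simp only [hw]; rw [← ofReal_mul, hmθ, ofReal_one, simplePow_one hW]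
    have hγ1 : ∀ l, γ θ l = 1 := fun l => by
      simp only [hγ]; rw [← ofReal_mul, hmθ]; simp
    rw [hΦ']
    refine Finset.sum_congr rfl fun i hi => ?_
    have hη1 : η θ i = μ i := by
      have : α + -(α / 2) * θ = 1 := by
        rw [hθ, hα, hm]; field_simp; ring
      simp only [hη]
      rw [← ofReal_mul, ← ofReal_add, this, ofReal_one, one_mul, ← ofReal_exp,
        Real.exp_log (hμ i hi)]
    simp only [hη1, hw1, hγ1, conj_ofReal, one_mul, hKdef, Finset.sum_mul]
  rw [← hval]
  refine key.trans (le_of_eq ?_)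
  rw [ofReal_re, Real.mul_rpow hC.le hS0, Real.mul_rpow (by positivity) hA0,
    Real.mul_rpow hC.le (Real.sqrt_nonneg _), Real.sqrt_eq_rpow, ← Real.rpow_mul hS0]
  have e1 : C ^ (1 - θ) * C ^ θ = C := by
    rw [← Real.rpow_add hC, sub_add_cancel, Real.rpow_one]
  have e2 : S ^ (1 - θ) * S ^ (1 / 2 * θ) = S ^ ((d + 1 : ℝ) / m) := by
    rw [← Real.rpow_add_of_nonneg hS0 (by linarith) (by positivity)]
    congr 1
    rw [hθ, hm]; field_simp; ring
  rw [← e2]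
  nth_rewrite 3 [← e1]
  ring

end Schatten

section Limit

variable {d : ℕ}

theorem ae_prod_fst_ne : ∀ᵐ p : (ℝ × Rd d) × (ℝ × Rd d), p.1.1 - p.2.1 ≠ 0 := by
  rw [Measure.volume_eq_prod, Measure.ae_prod_iff_ae_ae]
  · refine Eventually.of_forall fun X => ?_
    have h : ∀ᵐ s : ℝ, X.1 - s ≠ 0 := by
      filter_upwards [Measure.ae_ne volume X.1] with s hs
      exact sub_ne_zero.2 (Ne.symm hs)
    rw [Measure.volume_eq_prod]
    exact Measure.quasiMeasurePreserving_fst.ae h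
  · exact (isOpen_ne_fun (by fun_prop) continuous_const).measurableSet

theorem tendsto_bform_cutoff {χ : ℝ → ℝ} (hχc : Continuous χ) (hχb : ∀ x, |χ x| ≤ 1)
    (hχ1 : ∀ x, |x| ≤ 1 → χ x = 1) (hχ7 : ∀ x, 7 ≤ |x| → χ x = 0) {ε : ℝ} (hε : 0 < ε)
    {E F : ℝ × Rd d → ℂ} (hE : Integrable E) (hF : Integrable F) :
    Tendsto (fun L : ℕ => bform (fun X => (∑ l ∈ Finset.Ico (-(L : ℤ)) L,
        ((χ ((2 : ℝ) ^ (-l) * X.1) - χ (2 * ((2 : ℝ) ^ (-l) * X.1)) : ℝ) : ℂ)) * regKernel ε X) E F)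
      atTop (nhds (bform (regKernel ε) E F)) := by
  have hkb : ∀ X : ℝ × Rd d, ‖regKernel ε X‖ ≤ ε ^ (-(d / 2 : ℝ)) := fun X =>
    norm_regKernel_le hε X hε (Or.inl le_rfl)
  have hsum : ∀ (L : ℕ) (τ : ℝ), (∑ l ∈ Finset.Ico (-(L : ℤ)) L,
      ((χ ((2 : ℝ) ^ (-l) * τ) - χ (2 * ((2 : ℝ) ^ (-l) * τ)) : ℝ) : ℂ))
        = ((χ ((2:ℝ)^(-(L:ℤ)+1)*τ) - χ ((2:ℝ)^((L:ℤ)+1)*τ) : ℝ) : ℂ) := fun L τ => by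
    rw [← sum_dyadic_eq, ofReal_sum]
  simp only [hsum]
  set g : ℕ → ℝ → ℝ := fun L τ => χ ((2:ℝ)^(-(L:ℤ)+1)*τ) - χ ((2:ℝ)^((L:ℤ)+1)*τ) with hg
  have hgb : ∀ L τ, ‖g L τ‖ ≤ 2 := fun L τ => by
    rw [Real.norm_eq_abs]
    exact (abs_sub _ _).trans (by linarith [hχb ((2:ℝ)^(-(L:ℤ)+1)*τ), hχb ((2:ℝ)^((L:ℤ)+1)*τ)])
  have hgc : ∀ L, Continuous (g L) := fun L => by fun_prop
  have hKc : ∀ L, Continuous fun X : ℝ × Rd d => (g L X.1 : ℂ) * regKernel ε X := fun L =>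
    (continuous_ofReal.comp ((hgc L).comp continuous_fst)).mul (continuous_regKernel hε)
  have hKb : ∀ L (X : ℝ × Rd d), ‖(g L X.1 : ℂ) * regKernel ε X‖ ≤ 2 * ε ^ (-(d / 2 : ℝ)) :=
    fun L X => by
      rw [norm_mul, norm_real]
      exact mul_le_mul (hgb _ _) (hkb X) (norm_nonneg _) (by norm_num)
  change Tendsto (fun L => bform (fun X => (g L X.1 : ℂ) * regKernel ε X) E F) _ _
  unfold bform
  refine tendsto_integral_of_dominated_convergence
    (fun p => 2 * ε ^ (-(d / 2 : ℝ)) * (‖E p.1‖ * ‖F p.2‖)) (fun L => ?_) ?_ (fun L => ?_) ?_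
  · exact (integrable_bform (hKc L) (hKb L) hE hF).1
  · rw [Measure.volume_eq_prod]
    exact (hE.norm.mul_prod hF.norm).const_mul _
  · refine Eventually.of_forall fun p => ?_
    rw [norm_mul, norm_mul, RCLike.norm_conj]
    have h3 := mul_le_mul_of_nonneg_left (hKb L (p.1 - p.2)) (by positivity : 0 ≤ ‖E p.1‖ * ‖F p.2‖)
    linarith
  · filter_upwards [ae_prod_fst_ne] with p hp
    have h1 : Tendsto (fun L : ℕ => (2:ℝ)^(-(L:ℤ)+1)*(p.1 - p.2).1) atTop (nhds 0) := by
      have : Tendsto (fun L : ℕ => ((1/2:ℝ) ^ L) * (2 * (p.1 - p.2).1)) atTop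
          (nhds (0 * (2 * (p.1 - p.2).1))) :=
        (tendsto_pow_atTop_nhds_zero_of_lt_one (by norm_num) (by norm_num)).mul_const _
      rw [zero_mul] at this
      refine this.congr fun L => ?_
      rw [zpow_add₀ (by norm_num), zpow_neg, zpow_natCast, zpow_one, one_div, inv_pow, mul_assoc]
    have h2 : Tendsto (fun L : ℕ => |(2:ℝ)^((L:ℤ)+1)*(p.1 - p.2).1|) atTop atTop := by
      have : Tendsto (fun L : ℕ => ((2:ℝ) ^ L) * (2 * |(p.1 - p.2).1|)) atTop atTop :=
        (tendsto_pow_atTop_atTop_of_one_lt (by norm_num)).atTop_mul_const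
          (mul_pos two_pos (abs_pos.2 hp))
      refine this.congr fun L => ?_
      rw [abs_mul, zpow_add₀ (by norm_num), zpow_natCast, zpow_one, 
        abs_of_pos (by positivity : (0:ℝ) < 2 ^ L * 2), mul_assoc]
    refine tendsto_const_nhds.congr' ?_
    have h1' := h1.abs
    rw [abs_zero] at h1'
    filter_upwards [h1'.eventually (eventually_le_nhds zero_lt_one), h2.eventually_ge_atTop 7]
      with L ha hb
    have : g L (p.1 - p.2).1 = 1 := by rw [hg]; simp only; rw [hχ1 _ ha, hχ7 _ hb, sub_zero]
    rw [this, ofReal_one, one_mul]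

theorem exists_norm_sum_bform_regKernel_le (d : ℕ) : ∃ C : ℝ, 0 < C ∧
    ∀ {ε : ℝ}, 0 < ε → ∀ {ι : Type} (s : Finset ι)
      {e : ι → Lp ℂ 2 (volume : Measure (ℝ × Rd d))}, Orthonormal ℂ e → ∀ {μ : ι → ℝ},
      (∀ i ∈ s, 0 ≤ μ i) → ∀ {W : SimpleFunc (ℝ × Rd d) ℝ}, (∀ X, 0 ≤ W X) →
      W.FinMeasSupp volume → ∀ {A : ℝ}, 0 ≤ A →
      ∫⁻ X, ENNReal.ofReal (W X ^ (d + 2 : ℝ)) ≤ ENNReal.ofReal A →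
      ‖∑ i ∈ s, (μ i : ℂ) * bform (regKernel ε)
          (fun X => (W X : ℂ) * e i X) (fun X => (W X : ℂ) * e i X)‖
        ≤ C * (∑ i ∈ s, μ i ^ ((d + 2 : ℝ) / (d + 1))) ^ ((d + 1 : ℝ) / (d + 2))
          * A ^ (2 / (d + 2 : ℝ)) := by
  obtain ⟨χ, φ, C, hχc, hχb, hχ1, hχ7, hφ, hC, hA, hB⟩ :=
    exists_dyadic_kernel (d / 2 : ℝ) (by positivity)
  refine ⟨C, hC, fun {ε} hε {ι} s {e} he {μ} hμ {W} hW hWf {A} hA0 hWA => ?_⟩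
  classical
  set s' := s.filter fun i => 0 < μ i with hs'
  have hz : ∀ i ∈ s, i ∉ s' → μ i = 0 := fun i hi hi' =>
    le_antisymm (not_lt.1 fun h => hi' (Finset.mem_filter.2 ⟨hi, h⟩)) (hμ i hi)
  rw [← Finset.sum_subset (Finset.filter_subset (fun i => 0 < μ i) s)
      (fun i hi hi' => by rw [hz i hi hi', ofReal_zero, zero_mul]),
    ← Finset.sum_subset (Finset.filter_subset (fun i => 0 < μ i) s)
      (fun i hi hi' => by rw [hz i hi hi', Real.zero_rpow (by positivity)])]
  have hint : ∀ i, Integrable fun X => (W X : ℂ) * e i X := fun i => by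
    have h1 : MemLp (fun X => (W X : ℂ)) 2 (volume : Measure (ℝ × Rd d)) :=
      (SimpleFunc.memLp_of_finite_measure_preimage 2 (SimpleFunc.finMeasSupp_iff.1 hWf)).ofReal
    exact h1.integrable_mul (Lp.memLp (e i))
  have hlim := (tendsto_finsetSum s' fun i _ =>
    (tendsto_bform_cutoff hχc hχb hχ1 hχ7 hε (hint i) (hint i)).const_mul (μ i : ℂ)).norm
  refine le_of_tendsto hlim
    (Eventually.of_forall fun L => ?_)
  have := norm_sum_dyadic_bform_le φ.continuous (by simp [hφ]) (fun x => ?_) hC hA hB hε s' he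
    (fun i hi => (Finset.mem_filter.1 hi).2) hW hWf hA0 hWA (Finset.Ico (-(L : ℤ)) L)
  · simpa only [hφ] using this
  · rw [hφ, norm_real, Real.norm_eq_abs]
    exact (abs_sub _ _).trans (by linarith [hχb x, hχb (2 * x)])

end Limit

section GramSchmidt

open InnerProductSpace

variable {H : Type*} [NormedAddCommGroup H] [InnerProductSpace ℂ H]

theorem norm_sq_eq_sum_gramSchmidtNormed {N : ℕ} (f : Fin N → H) (j : Fin N) :
    ‖f j‖ ^ 2 = ∑ k ∈ Finset.Iic j, ‖⟪gramSchmidtNormed ℂ f k, f j⟫_ℂ‖ ^ 2 := by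
  have hterm : ∀ (z : ℂ) (r : ℝ), (starRingEnd ℂ) (z / (r : ℂ) ^ 2) * z
      = ((‖(r : ℂ)⁻¹ * z‖ ^ 2 : ℝ) : ℂ) := fun z r => by
    rw [map_div₀, map_pow, conj_ofReal, div_mul_eq_mul_div, mul_comm, mul_conj, norm_mul, mul_pow,
      normSq_eq_norm_sq, norm_inv, norm_real, Real.norm_eq_abs, inv_pow, sq_abs]
    push_cast
    rw [div_eq_inv_mul]
  have hin : ∀ k, ⟪gramSchmidtNormed ℂ f k, f j⟫_ℂ
      = (‖gramSchmidt ℂ f k‖ : ℂ)⁻¹ * ⟪gramSchmidt ℂ f k, f j⟫_ℂ := fun k => by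
    have : ((‖gramSchmidt ℂ f k‖ : ℂ)⁻¹) = (((‖gramSchmidt ℂ f k‖)⁻¹ : ℝ) : ℂ) := by push_cast; rfl
    rw [gramSchmidtNormed, inner_smul_left]
    simp only [Complex.coe_algebraMap]
    rw [this, conj_ofReal]
  have hgj : ⟪gramSchmidt ℂ f j, f j⟫_ℂ = (‖gramSchmidt ℂ f j‖ : ℂ) ^ 2 := by
    conv_lhs => rw [gramSchmidt_def'' ℂ f j]
    rw [inner_add_right, inner_sum, Finset.sum_eq_zero, add_zero, inner_self_eq_norm_sq_to_K]
    · rfl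
    · intro i hi
      rw [inner_smul_right, gramSchmidt_orthogonal ℂ f (Finset.mem_Iio.1 hi).ne', mul_zero]
  have hself : ((‖f j‖ ^ 2 : ℝ) : ℂ) = ⟪f j, f j⟫_ℂ := by
    rw [inner_self_eq_norm_sq_to_K]; push_cast; rfl
  have key : ((‖f j‖ ^ 2 : ℝ) : ℂ)
      = ((∑ k ∈ Finset.Iic j, ‖⟪gramSchmidtNormed ℂ f k, f j⟫_ℂ‖ ^ 2 : ℝ) : ℂ) := by
    rw [hself, ← Finset.Iio_insert, Finset.sum_insert (by simp)]
    have hdef : ∀ x, ⟪f j, x⟫_ℂ = ⟪gramSchmidt ℂ f j + ∑ i ∈ Finset.Iio j,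
        (⟪gramSchmidt ℂ f i, f j⟫_ℂ / (‖gramSchmidt ℂ f i‖ : ℂ) ^ 2) • gramSchmidt ℂ f i, x⟫_ℂ :=
      fun x => congrArg (fun y => ⟪y, x⟫_ℂ) (gramSchmidt_def'' ℂ f j)
    rw [hdef (f j), inner_add_left, sum_inner, hgj, ofReal_add, ofReal_sum]
    congr 1
    · rw [hin, hgj, norm_mul, norm_inv, norm_pow, norm_real, norm_norm]
      by_cases h0 : ‖gramSchmidt ℂ f j‖ = 0
      · simp [h0]
      · push_cast
        have : (‖gramSchmidt ℂ f j‖ : ℂ) ≠ 0 := ofReal_ne_zero.2 h0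
        field_simp
    · refine Finset.sum_congr rfl fun i _ => ?_
      rw [inner_smul_left, hin]
      exact hterm _ _
  exact_mod_cast key

theorem sum_mul_norm_sq_le_gramSchmidtNormed {N : ℕ} (f : Fin N → H) {n : Fin N → ℝ}
    (hn : ∀ j, 0 ≤ n j) (hanti : Antitone n) :
    ∑ j, n j * ‖f j‖ ^ 2 ≤ ∑ k, n k * ∑ j, ‖⟪gramSchmidtNormed ℂ f k, f j⟫_ℂ‖ ^ 2 := by
  simp only [Finset.mul_sum]
  rw [Finset.sum_comm]
  refine Finset.sum_le_sum fun j _ => ?_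
  rw [norm_sq_eq_sum_gramSchmidtNormed f j, Finset.mul_sum]
  calc _ ≤ ∑ k ∈ Finset.Iic j, n k * ‖⟪gramSchmidtNormed ℂ f k, f j⟫_ℂ‖ ^ 2 :=
        Finset.sum_le_sum fun k hk => by
          gcongr
          exact hanti (Finset.mem_Iic.1 hk)
    _ ≤ _ := Finset.sum_le_sum_of_subset_of_nonneg (Finset.subset_univ _)
      fun k _ _ => mul_nonneg (hn k) (by positivity)

end GramSchmidt

section Dual

variable {d : ℕ}

/-- The Gaussian-regularised Schrödinger wave with initial Fourier data `v`. -/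
def regWave {d : ℕ} (ε : ℝ) (v : Rd d → ℂ) (X : ℝ × Rd d) : ℂ :=
  ∫ ξ : Rd d, pwave (0, ξ) X * ((Real.exp (-(2 * π ^ 2 * ε * ‖ξ‖ ^ 2)) : ℂ) * v ξ)

theorem memLp_gaussian {ε : ℝ} (hε : 0 < ε) :
    MemLp (fun ξ : Rd d => (Real.exp (-(2 * π ^ 2 * ε * ‖ξ‖ ^ 2)) : ℂ)) 2 := by
  have hm : AEStronglyMeasurable (fun ξ : Rd d => Real.exp (-(2 * π ^ 2 * ε * ‖ξ‖ ^ 2))) volume :=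
    Continuous.aestronglyMeasurable (by fun_prop)
  refine MemLp.ofReal (f := fun ξ : Rd d => Real.exp (-(2 * π ^ 2 * ε * ‖ξ‖ ^ 2))) ?_
  rw [memLp_two_iff_integrable_sq hm]
  refine (integrable_gaussian_rd (d := d) (c := 4 * π ^ 2 * ε) (by positivity)).congr
    (Eventually.of_forall fun ξ => ?_)
  simp only
  rw [← Real.exp_nat_mul]
  congr 1
  push_cast
  ring

theorem integrable_gaussian_mul {ε : ℝ} (hε : 0 < ε) {v : Rd d → ℂ} (hv : MemLp v 2) :
    Integrable fun ξ : Rd d => (Real.exp (-(2 * π ^ 2 * ε * ‖ξ‖ ^ 2)) : ℂ) * v ξ :=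
  (memLp_gaussian hε).integrable_mul hv

theorem continuous_regWave {ε : ℝ} (hε : 0 < ε) {v : Rd d → ℂ} (hv : MemLp v 2) :
    Continuous (regWave ε v) := by
  have h := integrable_gaussian_mul hε hv
  refine continuous_of_dominated (fun X => ?_) (fun X => Eventually.of_forall fun ξ => ?_) h.norm
    (Eventually.of_forall fun ξ => ?_)
  · exact (Continuous.aestronglyMeasurable (by unfold pwave wave; fun_prop)).mul h.1
  · rw [norm_mul, norm_pwave, one_mul]
  · unfold pwave wave; fun_prop

theorem norm_regWave_le {ε : ℝ} {v : Rd d → ℂ} (X : ℝ × Rd d) :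
    ‖regWave ε v X‖ ≤ ∫ ξ : Rd d, ‖(Real.exp (-(2 * π ^ 2 * ε * ‖ξ‖ ^ 2)) : ℂ) * v ξ‖ := by
  refine (norm_integral_le_integral_norm _).trans (le_of_eq ?_)
  congr 1 with ξ
  rw [norm_mul, norm_pwave, one_mul]

theorem norm_integral_conj_pwave_le {E : ℝ × Rd d → ℂ} (ξ : Rd d) :
    ‖∫ X, (starRingEnd ℂ) (pwave (0, ξ) X) * E X‖ ≤ ∫ X, ‖E X‖ := by
  refine (norm_integral_le_integral_norm _).trans (le_of_eq ?_)
  congr 1 with X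
  rw [norm_mul, RCLike.norm_conj, norm_pwave, one_mul]

theorem continuous_integral_conj_pwave {E : ℝ × Rd d → ℂ} (hE : Integrable E) :
    Continuous fun ξ : Rd d => ∫ X, (starRingEnd ℂ) (pwave (0, ξ) X) * E X := by
  refine continuous_of_dominated (fun ξ => ?_) (fun ξ => Eventually.of_forall fun X => ?_) hE.norm
    (Eventually.of_forall fun X => ?_)
  · exact (Complex.continuous_conj.comp (by unfold pwave wave; fun_prop)).aestronglyMeasurable.mul
      hE.1
  · rw [norm_mul, RCLike.norm_conj, norm_pwave, one_mul]
  · exact (Complex.continuous_conj.comp (by unfold pwave wave; fun_prop)).mul continuous_const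

/-- The `L²` function representing the pairing of `E` against regularised waves. -/
theorem memLp_regDual {ε : ℝ} (hε : 0 < ε) {E : ℝ × Rd d → ℂ} (hE : Integrable E) :
    MemLp (fun ξ : Rd d => (Real.exp (-(2 * π ^ 2 * ε * ‖ξ‖ ^ 2)) : ℂ)
      * ∫ X, (starRingEnd ℂ) (pwave (0, ξ) X) * E X) 2 := by
  refine (memLp_gaussian hε).norm.of_le_mul (c := ∫ X, ‖E X‖)
    ((memLp_gaussian hε).1.mul (continuous_integral_conj_pwave hE).aestronglyMeasurable)
    (Eventually.of_forall fun ξ => ?_)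
  rw [norm_mul, norm_norm, mul_comm]
  gcongr
  exact norm_integral_conj_pwave_le ξ

theorem integral_conj_mul_regWave {ε : ℝ} (hε : 0 < ε) {E : ℝ × Rd d → ℂ} (hE : Integrable E)
    {v : Rd d → ℂ} (hv : MemLp v 2) :
    ∫ X, (starRingEnd ℂ) (E X) * regWave ε v X
      = ∫ ξ : Rd d, (starRingEnd ℂ) ((Real.exp (-(2 * π ^ 2 * ε * ‖ξ‖ ^ 2)) : ℂ)
        * ∫ X, (starRingEnd ℂ) (pwave (0, ξ) X) * E X) * v ξ := by
  have hg := integrable_gaussian_mul hε hv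
  have hEc : Integrable fun X => (starRingEnd ℂ) (E X) :=
    (LinearIsometryEquiv.integrable_comp_iff Complex.conjLIE).2 hE
  have hcw : Continuous fun p : (ℝ × Rd d) × Rd d => pwave ((0 : ℝ), p.2) p.1 := by
    unfold pwave wave; fun_prop
  conv_lhs => simp only [regWave, ← integral_const_mul]
  rw [integral_integral_swap]
  · congr 1 with ξ
    rw [map_mul, conj_ofReal, ← integral_conj, ← integral_const_mul, ← integral_mul_const]
    refine integral_congr_ae (Eventually.of_forall fun X => ?_)
    simp only [map_mul, Complex.conj_conj]
    ring
  · refine (hEc.mul_prod hg).mono ?_ (Eventually.of_forall fun p => ?_)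
    · exact (hEc.1.comp_fst).mul (hcw.aestronglyMeasurable.mul hg.1.comp_snd)
    · simp only [Function.uncurry, norm_mul, norm_pwave, one_mul, le_refl]

theorem bform_regKernel_eq {ε : ℝ} (hε : 0 < ε) {E : ℝ × Rd d → ℂ} (hE : Integrable E) :
    bform (regKernel ε) E E = ((∫ ξ : Rd d, ‖(Real.exp (-(2 * π ^ 2 * ε * ‖ξ‖ ^ 2)) : ℂ)
      * ∫ X, (starRingEnd ℂ) (pwave (0, ξ) X) * E X‖ ^ 2 : ℝ) : ℂ) := by
  have h := integral_kernel_fubini (ζ := (volume : Measure (Rd d)))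
    (μ := (volume : Measure (ℝ × Rd d)))
    (a := fun ξ => (Real.exp (-(4 * π ^ 2 * ε * ‖ξ‖ ^ 2)) : ℂ))
    (b := fun ξ X => pwave (0, ξ) X)
    (integrable_gaussian_rd (d := d) (c := 4 * π ^ 2 * ε) (by positivity)).ofReal
    (Continuous.measurable (by unfold Function.uncurry pwave wave; fun_prop))
    (fun ξ X => (norm_pwave _ _).le) hE hE
  rw [← integral_complex_ofReal]
  refine Eq.trans ?_ (h.trans ?_)
  · simp only [bform, regKernel, pwave_mul_conj, Measure.volume_eq_prod]
  · congr 1 with ξ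
    rw [norm_mul, mul_pow, norm_real, Real.norm_eq_abs, sq_abs, ← Real.exp_nat_mul, ofReal_mul,
      ← normSq_eq_norm_sq, ← mul_conj, mul_comm (∫ X, _)]
    congr 3
    push_cast
    ring

end Dual

section DualEstimate

variable {d : ℕ}

theorem norm_sq_toLp_eq {α : Type*} [MeasurableSpace α] {μ : Measure α} {f : α → ℂ}
    (hf : MemLp f 2 μ) : ‖hf.toLp f‖ ^ 2 = ∫ x, ‖f x‖ ^ 2 ∂μ := by
  have h : ((‖hf.toLp f‖ ^ 2 : ℝ) : ℂ) = ((∫ x, ‖f x‖ ^ 2 ∂μ : ℝ) : ℂ) := by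
    have h1 : ((‖hf.toLp f‖ ^ 2 : ℝ) : ℂ) = ⟪hf.toLp f, hf.toLp f⟫_ℂ := by
      rw [inner_self_eq_norm_sq_to_K]; push_cast; rfl
    rw [h1, L2.inner_def, ← integral_complex_ofReal]
    refine integral_congr_ae ?_
    filter_upwards [hf.coeFn_toLp] with x hx
    rw [hx, inner_self_eq_norm_sq_to_K]; push_cast; rfl
  exact_mod_cast h

theorem inner_toLp_toLp {α : Type*} [MeasurableSpace α] {μ : Measure α} {f g : α → ℂ}
    (hf : MemLp f 2 μ) (hg : MemLp g 2 μ) :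
    ⟪hf.toLp f, hg.toLp g⟫_ℂ = ∫ x, (starRingEnd ℂ) (f x) * g x ∂μ := by
  rw [L2.inner_def]
  refine integral_congr_ae ?_
  filter_upwards [hf.coeFn_toLp, hg.coeFn_toLp] with x hx hx'
  rw [hx, hx', RCLike.inner_apply, mul_comm]

theorem memLp_simpleFunc_mul_regWave {ε : ℝ} (hε : 0 < ε) {v : Rd d → ℂ} (hv : MemLp v 2)
    {W : SimpleFunc (ℝ × Rd d) ℝ} (hWf : W.FinMeasSupp volume) :
    MemLp (fun X => (W X : ℂ) * regWave ε v X) 2 volume := by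
  have hW2 : MemLp (fun X => (W X : ℂ)) 2 (volume : Measure (ℝ × Rd d)) :=
    (SimpleFunc.memLp_of_finite_measure_preimage 2 (SimpleFunc.finMeasSupp_iff.1 hWf)).ofReal
  refine hW2.norm.of_le_mul
    (c := ∫ ξ : Rd d, ‖(Real.exp (-(2 * π ^ 2 * ε * ‖ξ‖ ^ 2)) : ℂ) * v ξ‖)
    (hW2.1.mul (continuous_regWave hε hv).aestronglyMeasurable)
    (Eventually.of_forall fun X => ?_)
  rw [norm_mul, norm_norm, mul_comm]
  gcongr
  exact norm_regWave_le X

theorem sum_norm_inner_sq_le_bform {ε : ℝ} (hε : 0 < ε) {N : ℕ} {v : Fin N → L2 d}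
    (hv : Orthonormal ℂ v) {W : SimpleFunc (ℝ × Rd d) ℝ} (hWf : W.FinMeasSupp volume)
    (e : Lp ℂ 2 (volume : Measure (ℝ × Rd d))) :
    ∃ B : ℝ, bform (regKernel ε) (fun X => (W X : ℂ) * e X) (fun X => (W X : ℂ) * e X) = (B : ℂ) ∧
      0 ≤ B ∧ ∑ j, ‖⟪e, (memLp_simpleFunc_mul_regWave hε (Lp.memLp (v j)) hWf).toLp _⟫_ℂ‖ ^ 2 ≤ B := by
  have hW2 : MemLp (fun X => (W X : ℂ)) 2 (volume : Measure (ℝ × Rd d)) :=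
    (SimpleFunc.memLp_of_finite_measure_preimage 2 (SimpleFunc.finMeasSupp_iff.1 hWf)).ofReal
  have hE : Integrable fun X => (W X : ℂ) * e X := hW2.integrable_mul (Lp.memLp e)
  refine ⟨_, bform_regKernel_eq hε hE, integral_nonneg fun _ => by positivity, ?_⟩
  rw [← norm_sq_toLp_eq (memLp_regDual hε hE)]
  refine le_trans (le_of_eq (Finset.sum_congr rfl fun j _ => ?_))
    (hv.sum_inner_products_le ((memLp_regDual hε hE).toLp _) (s := Finset.univ))
  congr 1
  conv_rhs => rw [norm_inner_symm, ← Lp.toLp_coeFn (v j) (Lp.memLp _), inner_toLp_toLp,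
    ← integral_conj_mul_regWave hε hE (Lp.memLp _)]
  conv_lhs => rw [← Lp.toLp_coeFn e (Lp.memLp _), inner_toLp_toLp]
  congr 1
  refine integral_congr_ae (Eventually.of_forall fun X => ?_)
  simp only [map_mul, conj_ofReal]
  ring

theorem exists_sum_integral_sq_regWave_le (d : ℕ) : ∃ C : ℝ, 0 < C ∧
    ∀ {ε : ℝ}, 0 < ε → ∀ {N : ℕ} {v : Fin N → L2 d}, Orthonormal ℂ v → ∀ {n : Fin N → ℝ},
      (∀ j, 0 ≤ n j) → ∀ {W : SimpleFunc (ℝ × Rd d) ℝ}, (∀ X, 0 ≤ W X) →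
      W.FinMeasSupp volume → ∀ {A : ℝ}, 0 ≤ A →
      ∫⁻ X, ENNReal.ofReal (W X ^ (d + 2 : ℝ)) ≤ ENNReal.ofReal A →
      ∑ j, n j * ∫ X, ‖(W X : ℂ) * regWave ε (v j) X‖ ^ 2
        ≤ C * (∑ j, n j ^ ((d + 2 : ℝ) / (d + 1))) ^ ((d + 1 : ℝ) / (d + 2))
          * A ^ (2 / (d + 2 : ℝ)) := by
  obtain ⟨C, hC, hmain⟩ := exists_norm_sum_bform_regKernel_le d
  refine ⟨C, hC, fun {ε} hε {N} => ?_⟩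
  have hanti : ∀ {v : Fin N → L2 d}, Orthonormal ℂ v → ∀ {n : Fin N → ℝ},
      (∀ j, 0 ≤ n j) → Antitone n → ∀ {W : SimpleFunc (ℝ × Rd d) ℝ}, (∀ X, 0 ≤ W X) →
      W.FinMeasSupp volume → ∀ {A : ℝ}, 0 ≤ A →
      ∫⁻ X, ENNReal.ofReal (W X ^ (d + 2 : ℝ)) ≤ ENNReal.ofReal A →
      ∑ j, n j * ∫ X, ‖(W X : ℂ) * regWave ε (v j) X‖ ^ 2
        ≤ C * (∑ j, n j ^ ((d + 2 : ℝ) / (d + 1))) ^ ((d + 1 : ℝ) / (d + 2))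
          * A ^ (2 / (d + 2 : ℝ)) := by
    intro v hv n hn hna W hW hWf A hA hWA
    set f : Fin N → Lp ℂ 2 (volume : Measure (ℝ × Rd d)) := fun j =>
      (memLp_simpleFunc_mul_regWave hε (Lp.memLp (v j)) hWf).toLp _ with hf
    set e := InnerProductSpace.gramSchmidtNormed ℂ f with he
    choose B hB hB0 hBs using fun k => sum_norm_inner_sq_le_bform hε hv hWf (e k)
    have h1 := sum_mul_norm_sq_le_gramSchmidtNormed f hn hna
    classical
    have hfilt : ∀ g : Fin N → ℝ, ∑ k ∈ Finset.univ.filter (fun k => e k ≠ 0), g k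
        = ∑ k : {k | e k ≠ 0}, g k := fun g =>
      Finset.sum_subtype _ (fun k => by simp) g
    calc ∑ j, n j * ∫ X, ‖(W X : ℂ) * regWave ε (v j) X‖ ^ 2
        = ∑ j, n j * ‖f j‖ ^ 2 := Finset.sum_congr rfl fun j _ => by rw [hf, norm_sq_toLp_eq]
      _ ≤ ∑ k, n k * ∑ j, ‖⟪e k, f j⟫_ℂ‖ ^ 2 := h1
      _ = ∑ k ∈ Finset.univ.filter (fun k => e k ≠ 0), n k * ∑ j, ‖⟪e k, f j⟫_ℂ‖ ^ 2 := by
          refine (Finset.sum_subset (Finset.filter_subset _ _) fun k _ hk => ?_).symm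
          have : e k = 0 := by simpa using hk
          simp [this]
      _ = ∑ k : {k | e k ≠ 0}, n k * ∑ j, ‖⟪e k, f j⟫_ℂ‖ ^ 2 := hfilt _
      _ ≤ ∑ k : {k | e k ≠ 0}, n k * B k :=
          Finset.sum_le_sum fun k _ => mul_le_mul_of_nonneg_left (hBs k) (hn k)
      _ ≤ ‖∑ k : {k | e k ≠ 0}, (n k : ℂ) * bform (regKernel ε)
            (fun X => (W X : ℂ) * e k X) (fun X => (W X : ℂ) * e k X)‖ := by
          simp only [hB, ← ofReal_mul, ← ofReal_sum]
          rw [norm_real]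
          exact le_abs_self _
      _ ≤ C * (∑ k : {k | e k ≠ 0}, n k ^ ((d + 2 : ℝ) / (d + 1))) ^ ((d + 1 : ℝ) / (d + 2))
          * A ^ (2 / (d + 2 : ℝ)) :=
          hmain hε Finset.univ (InnerProductSpace.gramSchmidtNormed_orthonormal' f)
            (fun k _ => hn k) hW hWf hA hWA
      _ ≤ _ := by
          have h0 : ∀ k, 0 ≤ n k ^ ((d + 2 : ℝ) / (d + 1)) := fun k => Real.rpow_nonneg (hn k) _
          rw [← hfilt fun k => n k ^ ((d + 2 : ℝ) / (d + 1))]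
          gcongr
          · exact Finset.sum_nonneg fun k _ => h0 k
          · exact fun k _ _ => h0 k
          · exact Finset.subset_univ _
  intro v hv n hn W hW hWf A hA hWA
  set σ := Tuple.sort fun j => -n j with hσ
  have hmono : Antitone (n ∘ σ) := fun i j hij => by
    have := Tuple.monotone_sort (fun j => -n j) hij
    simpa using this
  have h := hanti (hv.comp σ σ.injective) (fun j => hn (σ j)) hmono hW hWf hA hWA
  simp only [Function.comp] at h
  rwa [Equiv.sum_comp σ (fun j => n j ^ ((d + 2 : ℝ) / (d + 1))),
    Equiv.sum_comp σ (fun j => n j * ∫ X, ‖(W X : ℂ) * regWave ε (v j) X‖ ^ 2)] at h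

end DualEstimate

section Endpoint

variable {d : ℕ}

theorem exists_simpleFunc_approx {α : Type*} [MeasurableSpace α] {μ : Measure α} {w : α → ℝ}
    (hw : Measurable w) (hw0 : ∀ x, 0 ≤ w x) (hμ : μ (Function.support w) < ∞) :
    ∃ W : ℕ → SimpleFunc α ℝ, (∀ k x, 0 ≤ W k x) ∧ (∀ k x, W k x ≤ w x) ∧
      (∀ k, (W k).FinMeasSupp μ) ∧ ∀ x, Tendsto (fun k => W k x) atTop (nhds (w x)) := by
  set f : α → ℝ≥0∞ := fun x => ENNReal.ofReal (w x) with hf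
  have hfm : Measurable f := hw.ennreal_ofReal
  have hle : ∀ k x, ((SimpleFunc.eapprox f k).map ENNReal.toReal) x ≤ w x := fun k x => by
    rw [SimpleFunc.map_apply]
    refine ENNReal.toReal_le_of_le_ofReal (hw0 x) ?_
    change _ ≤ f x
    rw [← SimpleFunc.iSup_eapprox_apply hfm x]
    exact le_iSup (fun k => (SimpleFunc.eapprox f k) x) k
  refine ⟨fun k => (SimpleFunc.eapprox f k).map ENNReal.toReal,
    fun k x => ENNReal.toReal_nonneg, hle, fun k => ?_, fun x => ?_⟩
  · refine lt_of_le_of_lt (measure_mono fun x hx => ?_) hμ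
    have h0 : 0 ≤ ((SimpleFunc.eapprox f k).map ENNReal.toReal) x := ENNReal.toReal_nonneg
    exact ((h0.lt_of_ne (Ne.symm hx)).trans_le (hle k x)).ne'
  · have h := (ENNReal.tendsto_toReal (ENNReal.ofReal_ne_top (r := w x))).comp
      (SimpleFunc.tendsto_eapprox hfm x)
    rwa [ENNReal.toReal_ofReal (hw0 x)] at h

theorem le_rpow_of_le_mul_rpow {J K a : ℝ} (hJ : 0 ≤ J) (hK : 0 ≤ K) (ha1 : a < 1)
    (h : J ≤ K * J ^ a) : J ≤ K ^ (1 / (1 - a)) := by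
  rcases hJ.eq_or_lt with rfl | hJ
  · positivity
  have h1 : J ^ (1 - a) ≤ K := by
    rw [Real.rpow_sub hJ, Real.rpow_one]
    exact (div_le_iff₀ (by positivity)).2 h
  calc J = (J ^ (1 - a)) ^ (1 / (1 - a)) := by
        rw [← Real.rpow_mul hJ.le, mul_one_div_cancel (by linarith), Real.rpow_one]
    _ ≤ _ := by
        refine Real.rpow_le_rpow (by positivity) h1 (one_div_nonneg.2 (by linarith))

theorem exists_lintegral_density_regWave_le (hd : 1 ≤ d) : ∃ C : ℝ, 0 < C ∧
    ∀ {ε : ℝ}, 0 < ε → ∀ {N : ℕ} {v : Fin N → L2 d}, Orthonormal ℂ v → ∀ {n : Fin N → ℝ},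
      (∀ j, 0 ≤ n j) →
      ∫⁻ X, ENNReal.ofReal ((∑ j, n j * ‖regWave ε (v j) X‖ ^ 2) ^ (1 + 2 / d : ℝ))
        ≤ ENNReal.ofReal ((C * (∑ j, n j ^ ((d + 2 : ℝ) / (d + 1))) ^ ((d + 1 : ℝ) / (d + 2)))
          ^ (1 + 2 / d : ℝ)) := by
  obtain ⟨C, hC, hmain⟩ := exists_sum_integral_sq_regWave_le d
  refine ⟨C, hC, fun {ε} hε {N v} hv {n} hn => ?_⟩
  have hd0 : (0 : ℝ) < d := by exact_mod_cast hd
  set S := C * (∑ j, n j ^ ((d + 2 : ℝ) / (d + 1))) ^ ((d + 1 : ℝ) / (d + 2)) with hS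
  have hS0 : 0 ≤ S := mul_nonneg hC.le
    (Real.rpow_nonneg (Finset.sum_nonneg fun j _ => Real.rpow_nonneg (hn j) _) _)
  set ρ : ℝ × Rd d → ℝ := fun X => ∑ j, n j * ‖regWave ε (v j) X‖ ^ 2 with hρ
  have hρ0 : ∀ X, 0 ≤ ρ X := fun X =>
    Finset.sum_nonneg fun j _ => mul_nonneg (hn j) (by positivity)
  have hψc : ∀ j, Continuous (regWave ε (v j)) := fun j => continuous_regWave hε (Lp.memLp (v j))
  have hρc : Continuous ρ := continuous_finsetSum _ fun j _ =>
    continuous_const.mul ((hψc j).norm.pow 2)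
  have hball : ∀ r : ℕ, ∫⁻ X in Metric.closedBall 0 r, ENNReal.ofReal (ρ X ^ (1 + 2 / d : ℝ))
      ≤ ENNReal.ofReal (S ^ (1 + 2 / d : ℝ)) := by
    intro r
    set K := Metric.closedBall (0 : ℝ × Rd d) r with hK
    have hKm : MeasurableSet K := Metric.isClosed_closedBall.measurableSet
    have hKc : IsCompact K := isCompact_closedBall _ _
    set w : ℝ × Rd d → ℝ := K.indicator fun X => ρ X ^ (1 / d : ℝ) with hw
    have hwm : Measurable w := (hρc.measurable.pow_const _).indicator hKm
    have hw0 : ∀ X, 0 ≤ w X := fun X => Set.indicator_nonneg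
      (fun X _ => Real.rpow_nonneg (hρ0 X) _) X
    have hws : volume (Function.support w) < ∞ :=
      (measure_mono Set.support_indicator_subset).trans_lt hKc.measure_lt_top
    have hw1 : ∀ X, w X ^ (d + 2 : ℝ) = K.indicator (fun X => ρ X ^ (1 + 2 / d : ℝ)) X := by
      intro X
      by_cases hX : X ∈ K
      · rw [hw, Set.indicator_of_mem hX, Set.indicator_of_mem hX, ← Real.rpow_mul (hρ0 X)]
        congr 1
        field_simp
      · rw [hw, Set.indicator_of_notMem hX, Set.indicator_of_notMem hX,
          Real.zero_rpow (by positivity)]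
    have hw2 : ∀ X, w X ^ 2 * ρ X = w X ^ (d + 2 : ℝ) := by
      intro X
      rw [hw1]
      by_cases hX : X ∈ K
      · rw [hw, Set.indicator_of_mem hX, Set.indicator_of_mem hX, ← Real.rpow_natCast,
          ← Real.rpow_mul (hρ0 X), add_comm, Real.rpow_add_of_nonneg (hρ0 X) (by positivity)
          zero_le_one, Real.rpow_one]
        congr 2
        push_cast
        ring
      · rw [hw, Set.indicator_of_notMem hX, Set.indicator_of_notMem hX]
        simp
    obtain ⟨W, hW0, hWle, hWf, hWt⟩ := exists_simpleFunc_approx hwm hw0 hws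
    set J : ℝ≥0∞ := ∫⁻ X, ENNReal.ofReal (w X ^ (d + 2 : ℝ)) with hJ
    have hJeq : J = ∫⁻ X in K, ENNReal.ofReal (ρ X ^ (1 + 2 / d : ℝ)) := by
      rw [hJ, ← lintegral_indicator hKm]
      refine lintegral_congr fun X => ?_
      rw [hw1]
      by_cases hX : X ∈ K
      · rw [Set.indicator_of_mem hX, Set.indicator_of_mem hX]
      · rw [Set.indicator_of_notMem hX, Set.indicator_of_notMem hX, ENNReal.ofReal_zero]
    have hJfin : J ≠ ∞ := by
      rw [hJeq]
      have hc : ContinuousOn (fun X => ρ X ^ (1 + 2 / d : ℝ)) K :=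
        (hρc.rpow_const fun X => Or.inr (by positivity)).continuousOn
      exact (hc.integrableOn_compact hKc).lintegral_lt_top.ne
    have hJle : ∀ k, ∫⁻ X, ENNReal.ofReal (W k X ^ 2 * ρ X)
        ≤ ENNReal.ofReal (S * J.toReal ^ (2 / (d + 2 : ℝ))) := by
      intro k
      have hint : ∀ j, Integrable fun X => ‖(W k X : ℂ) * regWave ε (v j) X‖ ^ 2 := fun j =>
        (memLp_simpleFunc_mul_regWave hε (Lp.memLp (v j)) (hWf k)).integrable_norm_pow two_ne_zero
      have hsum : ∀ X, W k X ^ 2 * ρ X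
          = ∑ j, n j * ‖(W k X : ℂ) * regWave ε (v j) X‖ ^ 2 := fun X => by
        rw [hρ, Finset.mul_sum]
        refine Finset.sum_congr rfl fun j _ => ?_
        rw [norm_mul, mul_pow, norm_real, Real.norm_eq_abs, sq_abs]
        ring
      simp only [hsum]
      rw [← ofReal_integral_eq_lintegral_ofReal
        (integrable_finsetSum _ fun j _ => (hint j).const_mul (n j))
        (Eventually.of_forall fun X => Finset.sum_nonneg fun j _ =>
          mul_nonneg (hn j) (by positivity)),
        integral_finsetSum _ fun j _ => (hint j).const_mul (n j)]
      simp only [integral_const_mul]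
      refine ENNReal.ofReal_le_ofReal (hmain hε hv hn (hW0 k) (hWf k) ENNReal.toReal_nonneg ?_)
      rw [ENNReal.ofReal_toReal hJfin]
      refine lintegral_mono fun X => ENNReal.ofReal_le_ofReal ?_
      exact Real.rpow_le_rpow (hW0 k X) (hWle k X) (by positivity)
    have hJ1 : J ≤ ENNReal.ofReal (S * J.toReal ^ (2 / (d + 2 : ℝ))) := by
      calc J = ∫⁻ X, liminf (fun k => ENNReal.ofReal (W k X ^ 2 * ρ X)) atTop := by
            refine lintegral_congr fun X => ?_
            rw [← hw2]
            exact (ENNReal.tendsto_ofReal (((hWt X).pow 2).mul_const _)).liminf_eq.symm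
        _ ≤ liminf (fun k => ∫⁻ X, ENNReal.ofReal (W k X ^ 2 * ρ X)) atTop :=
            lintegral_liminf_le fun k => (((W k).measurable.pow_const 2).mul
              hρc.measurable).ennreal_ofReal
        _ ≤ _ := liminf_le_of_le (by isBoundedDefault) fun b hb => by
            obtain ⟨k, hk⟩ := hb.exists
            exact hk.trans (hJle k)
    have hJ2 : J.toReal ≤ S * J.toReal ^ (2 / (d + 2 : ℝ)) :=
      ENNReal.toReal_le_of_le_ofReal (by positivity) hJ1
    have hJ3 := le_rpow_of_le_mul_rpow ENNReal.toReal_nonneg hS0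
      ((div_lt_one (by positivity)).2 (by linarith)) hJ2
    rw [← hJeq, ← ENNReal.ofReal_toReal hJfin]
    refine ENNReal.ofReal_le_ofReal (hJ3.trans_eq ?_)
    congr 1
    rw [show (1 : ℝ) - 2 / (d + 2) = d / (d + 2) by field_simp; ring, one_div_div, add_div,
      div_self hd0.ne']
  rw [← setLIntegral_univ, ← Metric.iUnion_closedBall_nat (0 : ℝ × Rd d),
    setLIntegral_iUnion_of_directed]
  · exact iSup_le hball
  · exact (Monotone.directed_le fun i j hij =>
      Metric.closedBall_subset_closedBall (by exact_mod_cast hij))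

end Endpoint

section InverseFourier

variable {V : Type*} [NormedAddCommGroup V] [InnerProductSpace ℝ V] [FiniteDimensional ℝ V]
  [MeasurableSpace V] [BorelSpace V]

theorem integral_fourierInv_mul_eq {f g : V → ℂ} (hf : Integrable f) (hg : Integrable g) :
    ∫ w, 𝓕⁻ f w * g w = ∫ x, f x * 𝓕⁻ g x := by
  have h := integral_fourier_mul_eq hg.comp_neg hf
  rw [← integral_neg_eq_self (fun w => 𝓕⁻ f w * g w), Real.fourierInv_eq_fourier_comp_neg g]
  simp only [Real.fourierInv_eq_fourier_neg, neg_neg]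
  exact h

theorem fourierInv_toLp_ae_eq {f : V → ℂ} (hf : Integrable f) (hf2 : MemLp f 2) :
    (𝓕⁻ (hf2.toLp f) : Lp ℂ 2 (volume : Measure V)) =ᵐ[volume] 𝓕⁻ f := by
  have hcont : Continuous (𝓕⁻ f) := by
    have h1 : 𝓕⁻ f = fun w => 𝓕 f (-w) := funext fun w => Real.fourierInv_eq_fourier_neg f w
    rw [h1]
    exact (continuous_fourier_of_integrable hf).comp continuous_neg
  apply ae_eq_of_integral_contDiff_smul_eq
  · exact (Lp.memLp _).locallyIntegrable (by norm_num)
  · exact hcont.locallyIntegrable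
  intro g hg hgc
  have hgc' : HasCompactSupport (fun x => (g x : ℂ)) :=
    hgc.comp_left (g := fun r : ℝ => (r : ℂ)) (by simp)
  have hg' : ContDiff ℝ ((⊤ : ℕ∞) : WithTop ℕ∞) (fun x => (g x : ℂ)) :=
    Complex.ofRealCLM.contDiff.comp hg
  set G : SchwartzMap V ℂ := hgc'.toSchwartzMap hg' with hG
  have hGx : ∀ x, G x = g x := fun x => rfl
  have h := congrArg (fun T => T G) (Lp.fourierInv_toTemperedDistribution_eq (hf2.toLp f))
  simp only [TemperedDistribution.fourierInv_apply, Lp.toTemperedDistribution_apply] at h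
  have e1 : ∫ x, g x • (𝓕⁻ (hf2.toLp f) : Lp ℂ 2 (volume : Measure V)) x
      = ∫ x, (𝓕⁻ G) x • (hf2.toLp f) x := by
    rw [h]; simp [hGx]
  rw [e1]
  have e2 : ∫ x, (𝓕⁻ G) x • (hf2.toLp f) x = ∫ x, f x * (𝓕⁻ (G : V → ℂ)) x := by
    apply integral_congr_ae
    filter_upwards [hf2.coeFn_toLp] with x hx
    rw [hx, SchwartzMap.fourierInv_coe, mul_comm]; rfl
  rw [e2, ← integral_fourierInv_mul_eq hf G.integrable]
  refine integral_congr_ae (Eventually.of_forall fun x => ?_)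
  simp [hGx, mul_comm]

end InverseFourier

section Propagator

variable {d : ℕ}

/-- The Fourier symbol `e^{-it|2πξ|²}` of the free Schrödinger propagator. -/
def schrodingerSymbol {d : ℕ} (t : ℝ) (ξ : Rd d) : ℂ :=
  cexp (-(I * t * (4 * (π : ℂ) ^ 2 * (‖ξ‖ : ℂ) ^ 2)))

theorem norm_schrodingerSymbol (t : ℝ) (ξ : Rd d) : ‖schrodingerSymbol t ξ‖ = 1 := by
  have : -(I * t * (4 * (π : ℂ) ^ 2 * (‖ξ‖ : ℂ) ^ 2))
      = ((-(t * (4 * π ^ 2 * ‖ξ‖ ^ 2)) : ℝ) : ℂ) * I := by push_cast; ring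
  rw [schrodingerSymbol, this, norm_exp_ofReal_mul_I]

theorem continuous_schrodingerSymbol (t : ℝ) :
    Continuous (schrodingerSymbol t : Rd d → ℂ) := by
  unfold schrodingerSymbol; fun_prop

theorem hasTemperateGrowth_cexp_mul_I (c : ℝ) :
    (fun s : ℝ => cexp ((c : ℂ) * I * s)).HasTemperateGrowth := by
  have hiter : ∀ n : ℕ, iteratedDeriv n (fun s : ℝ => cexp ((c : ℂ) * I * s))
      = fun s : ℝ => ((c : ℂ) * I) ^ n * cexp ((c : ℂ) * I * s) := by
    intro n
    induction n with
    | zero => simp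
    | succ n ih =>
      rw [iteratedDeriv_succ, ih]
      funext s
      have h1 : HasDerivAt (fun s : ℝ => (c : ℂ) * I * (s : ℂ)) ((c : ℂ) * I) s := by
        simpa using (Complex.ofRealCLM.hasDerivAt (x := s)).const_mul ((c : ℂ) * I)
      have h2 := (h1.cexp.const_mul (((c : ℂ) * I) ^ n)).deriv
      rw [h2]; ring
  refine ⟨?_, fun n => ⟨0, |c| ^ n, fun s => ?_⟩⟩
  · have : ContDiff ℝ ((⊤ : ℕ∞) : WithTop ℕ∞) fun s : ℝ => (c : ℂ) * I * (s : ℂ) :=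
      contDiff_const.mul Complex.ofRealCLM.contDiff
    exact this.cexp
  · rw [norm_iteratedFDeriv_eq_norm_iteratedDeriv, hiter]
    have : (c : ℂ) * I * s = ((c * s : ℝ) : ℂ) * I := by push_cast; ring
    simp only
    rw [this, norm_mul, norm_exp_ofReal_mul_I]
    simp

theorem hasTemperateGrowth_schrodingerSymbol (t : ℝ) :
    (schrodingerSymbol t : Rd d → ℂ).HasTemperateGrowth := by
  have h := (hasTemperateGrowth_cexp_mul_I (-(t * (4 * π ^ 2)))).comp
    (Function.hasTemperateGrowth_norm_sq (H := Rd d))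
  have heq : (schrodingerSymbol t : Rd d → ℂ)
      = (fun s : ℝ => cexp (((-(t * (4 * π ^ 2)) : ℝ) : ℂ) * I * s)) ∘ fun ξ => ‖ξ‖ ^ 2 := by
    funext ξ
    simp only [schrodingerSymbol, Function.comp]
    congr 1
    push_cast
    ring
  rw [heq]
  exact h

theorem memLp_schrodingerSymbol_mul {t : ℝ} {f : Rd d → ℂ} (hf : MemLp f 2) :
    MemLp (fun ξ => schrodingerSymbol t ξ * f ξ) 2 :=
  hf.of_le ((continuous_schrodingerSymbol t).aestronglyMeasurable.mul hf.1)
    (Eventually.of_forall fun ξ => by simp [norm_schrodingerSymbol])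

/-- Multiplication of an `L²` function by the Schrödinger symbol. -/
def symbolMul {d : ℕ} (t : ℝ) (w : L2 d) : L2 d :=
  (memLp_schrodingerSymbol_mul (t := t) (Lp.memLp w)).toLp _

theorem coeFn_symbolMul (t : ℝ) (w : L2 d) :
    symbolMul t w =ᵐ[volume] fun ξ => schrodingerSymbol t ξ * w ξ :=
  MemLp.coeFn_toLp _

theorem continuous_symbolMul (t : ℝ) : Continuous (symbolMul (d := d) t) := by
  refine LipschitzWith.continuous (K := 1) (LipschitzWith.of_dist_le_mul fun v w => ?_)
  rw [NNReal.coe_one, one_mul, dist_eq_norm, dist_eq_norm]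
  refine Lp.norm_le_norm_of_ae_le ?_
  filter_upwards [coeFn_symbolMul t v, coeFn_symbolMul t w, Lp.coeFn_sub v w,
    Lp.coeFn_sub (symbolMul t v) (symbolMul t w)] with ξ h1 h2 h3 h4
  rw [h4, h3, Pi.sub_apply, Pi.sub_apply, h1, h2, ← mul_sub, norm_mul, norm_schrodingerSymbol,
    one_mul]

theorem IsSchrodingerPropagator.fourier_apply {U : ℝ → (L2 d ≃ₗᵢ[ℂ] L2 d)}
    (hU : IsSchrodingerPropagator U) (t : ℝ) (u : L2 d) :
    𝓕 (U t u) = symbolMul t (𝓕 u) := by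
  have hF : Continuous fun w : L2 d => 𝓕 w := (Lp.fourierTransformₗᵢ (Rd d) ℂ).continuous
  have hd : DenseRange (SchwartzMap.toLpCLM ℂ ℂ 2 (volume : Measure (Rd d))) :=
    SchwartzMap.denseRange_toLpCLM ENNReal.ofNat_ne_top
  refine congrFun (hd.equalizer (g := fun u => 𝓕 (U t u)) (h := fun u => symbolMul t (𝓕 u))
    (hF.comp (U t).continuous) ((continuous_symbolMul t).comp hF) (funext fun f => ?_)) u
  simp only [Function.comp, SchwartzMap.toLpCLM_apply]
  set g : SchwartzMap (Rd d) ℂ := 𝓕⁻ (SchwartzMap.smulLeftCLM ℂ (schrodingerSymbol t) (𝓕 f))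
    with hg
  have hFg : 𝓕 g = SchwartzMap.smulLeftCLM ℂ (schrodingerSymbol t) (𝓕 f) := by
    rw [hg, FourierTransform.fourier_fourierInv_eq]
  have hFgx : ∀ ξ, (𝓕 g) ξ = schrodingerSymbol t ξ * (𝓕 f) ξ := fun ξ => by
    rw [hFg, SchwartzMap.smulLeftCLM_apply (hasTemperateGrowth_schrodingerSymbol t)]; rfl
  have h1 : U t (f.toLp 2) = g.toLp 2 := by
    refine Lp.ext ((hU t f g (f.toLp 2) (f.coeFn_toLp 2 volume) fun ξ => ?_).trans
      (g.coeFn_toLp 2 volume).symm)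
    have := hFgx ξ
    rwa [SchwartzMap.fourier_coe, SchwartzMap.fourier_coe] at this
  rw [h1, SchwartzMap.toLp_fourier_eq, SchwartzMap.toLp_fourier_eq]
  refine Lp.ext ?_
  filter_upwards [(𝓕 g).coeFn_toLp 2 volume, coeFn_symbolMul t ((𝓕 f).toLp 2),
    (𝓕 f).coeFn_toLp 2 volume] with ξ h2 h3 h4
  rw [h2, h3, h4, hFgx]

theorem regWave_eq_fourierInv (ε t : ℝ) (v : Rd d → ℂ) (x : Rd d) :
    regWave ε v (t, x) = 𝓕⁻ (fun ξ => schrodingerSymbol t ξ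
      * ((Real.exp (-(2 * π ^ 2 * ε * ‖ξ‖ ^ 2)) : ℂ) * v ξ)) x := by
  rw [Real.fourierInv_eq', regWave]
  refine integral_congr_ae (Eventually.of_forall fun ξ => ?_)
  simp only
  rw [smul_eq_mul, schrodingerSymbol, ← mul_assoc (cexp _) (cexp _), ← Complex.exp_add, pwave,
    wave]
  congr 2
  rw [real_inner_comm]
  push_cast
  ring

end Propagator

section Approximation

variable {d : ℕ}

/-- The squared `L²` distance between the regularised and the unregularised wave. -/
def regError {d : ℕ} (ε : ℝ) (v : Rd d → ℂ) : ℝ≥0∞ :=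
  ∫⁻ ξ, ‖((Real.exp (-(2 * π ^ 2 * ε * ‖ξ‖ ^ 2)) : ℂ) - 1) * v ξ‖ₑ ^ 2

theorem norm_gaussian_le_one {ε : ℝ} (hε : 0 ≤ ε) (ξ : Rd d) :
    ‖(Real.exp (-(2 * π ^ 2 * ε * ‖ξ‖ ^ 2)) : ℂ)‖ ≤ 1 := by
  rw [norm_real, Real.norm_eq_abs, Real.abs_exp, Real.exp_le_one_iff, neg_nonpos]
  positivity

theorem memLp_gaussian_mul {ε : ℝ} (hε : 0 ≤ ε) {v : Rd d → ℂ} (hv : MemLp v 2) :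
    MemLp (fun ξ => (Real.exp (-(2 * π ^ 2 * ε * ‖ξ‖ ^ 2)) : ℂ) * v ξ) 2 :=
  hv.of_le ((Continuous.aestronglyMeasurable (by fun_prop)).mul hv.1)
    (Eventually.of_forall fun ξ => by
      rw [norm_mul]
      exact mul_le_of_le_one_left (norm_nonneg _) (norm_gaussian_le_one hε ξ))

theorem IsSchrodingerPropagator.lintegral_regWave_sub {U : ℝ → (L2 d ≃ₗᵢ[ℂ] L2 d)}
    (hU : IsSchrodingerPropagator U) {ε : ℝ} (hε : 0 < ε) (t : ℝ) (u : L2 d) :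
    ∫⁻ x, ‖regWave ε (𝓕 u : L2 d) (t, x) - U t u x‖ₑ ^ 2 = regError ε (𝓕 u : L2 d) := by
  set v : L2 d := 𝓕 u with hv
  have hw2 := memLp_schrodingerSymbol_mul (t := t) (memLp_gaussian_mul hε.le (Lp.memLp v))
  have hw1 : Integrable fun ξ => schrodingerSymbol t ξ
      * ((Real.exp (-(2 * π ^ 2 * ε * ‖ξ‖ ^ 2)) : ℂ) * v ξ) :=
    (integrable_gaussian_mul hε (Lp.memLp v)).bdd_mul (c := 1)
      (continuous_schrodingerSymbol t).aestronglyMeasurable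
      (Eventually.of_forall fun ξ => (norm_schrodingerSymbol t ξ).le)
  have hinv := fourierInv_toLp_ae_eq hw1 hw2
  set W : L2 d := hw2.toLp _ with hW
  have hUt : U t u = 𝓕⁻ (symbolMul t v) := by
    rw [hv, ← hU.fourier_apply, FourierTransform.fourierInv_fourier_eq]
  have hsub : 𝓕⁻ W - U t u = 𝓕⁻ (W - symbolMul t v) := by
    rw [hUt]
    exact ((Lp.fourierTransformₗᵢ (Rd d) ℂ).symm.map_sub W (symbolMul t v)).symm
  have hnorm : ‖𝓕⁻ W - U t u‖ = ‖W - symbolMul t v‖ := by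
    rw [hsub]
    exact (Lp.fourierTransformₗᵢ (Rd d) ℂ).symm.norm_map _
  calc _ = ∫⁻ x, ‖(𝓕⁻ W - U t u : L2 d) x‖ₑ ^ 2 := by
        refine lintegral_congr_ae ?_
        filter_upwards [hinv, Lp.coeFn_sub (𝓕⁻ W) (U t u)] with x h1 h2
        rw [h2, Pi.sub_apply, h1, regWave_eq_fourierInv]
    _ = ∫⁻ ξ, ‖(W - symbolMul t v : L2 d) ξ‖ₑ ^ 2 := by
        rw [lintegral_enorm_sq_Lp, lintegral_enorm_sq_Lp, hnorm]
    _ = _ := by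
        refine lintegral_congr_ae ?_
        filter_upwards [hw2.coeFn_toLp, coeFn_symbolMul t v, Lp.coeFn_sub W (symbolMul t v)]
          with ξ h1 h2 h3
        rw [h3, Pi.sub_apply, h1, h2, ← mul_sub, enorm_mul, ← ofReal_norm,
          norm_schrodingerSymbol, ENNReal.ofReal_one, one_mul, sub_mul, one_mul]

theorem tendsto_regError {v : Rd d → ℂ} (hv : MemLp v 2) :
    Tendsto (fun ε => regError ε v) (nhdsWithin 0 (Set.Ioi 0)) (nhds 0) := by
  have hz : (0 : ℝ≥0∞) = ∫⁻ _ : Rd d, 0 := by simp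
  rw [hz]
  refine tendsto_lintegral_filter_of_dominated_convergence' (fun ξ => 2 ^ 2 * ‖v ξ‖ₑ ^ 2) ?_ ?_ ?_ ?_
  · refine Eventually.of_forall fun ε => ?_
    exact (((Continuous.aestronglyMeasurable (by fun_prop)).mul hv.1).enorm).pow_const 2
  · filter_upwards [self_mem_nhdsWithin] with ε hε
    refine Eventually.of_forall fun ξ => ?_
    rw [enorm_mul, mul_pow]
    gcongr
    rw [← ofReal_norm]
    refine (ENNReal.ofReal_le_ofReal ((norm_sub_le _ _).trans (?_ : _ ≤ (2 : ℝ)))).trans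
      (ENNReal.ofReal_ofNat 2).le
    have := norm_gaussian_le_one (le_of_lt hε) ξ
    rw [norm_one]
    linarith
  · rw [lintegral_const_mul' _ _ (by simp), ← eLpNorm_two_sq]
    exact ENNReal.mul_ne_top (by simp) (ENNReal.pow_ne_top hv.2.ne)
  · refine Eventually.of_forall fun ξ => ?_
    have hc : Continuous fun ε : ℝ =>
        ‖((Real.exp (-(2 * π ^ 2 * ε * ‖ξ‖ ^ 2)) : ℂ) - 1) * v ξ‖ₑ ^ 2 := by
      have : Continuous fun ε : ℝ =>
        ((Real.exp (-(2 * π ^ 2 * ε * ‖ξ‖ ^ 2)) : ℂ) - 1) * v ξ := by fun_prop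
      exact (ENNReal.continuous_pow 2).comp this.enorm
    have h0 := (hc.tendsto 0).mono_left (nhdsWithin_le_nhds (s := Set.Ioi 0))
    simpa using h0

theorem IsSchrodingerPropagator.exists_tendsto_regWave (u : ℕ → L2 d) :
    ∃ ε : ℕ → ℝ, (∀ ν, 0 < ε ν) ∧ ∀ {U : ℝ → (L2 d ≃ₗᵢ[ℂ] L2 d)}, IsSchrodingerPropagator U →
      ∀ j t, ∀ᵐ x, Tendsto (fun ν => regWave (ε ν) (𝓕 (u j) : L2 d) (t, x)) atTop
        (nhds (U t (u j) x)) := by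
  have hex : ∀ ν : ℕ, ∃ ε : ℝ, 0 < ε ∧ ∀ j ∈ Finset.range (ν + 1),
      regError ε (𝓕 (u j) : L2 d) ≤ (1 / 4 : ℝ≥0∞) ^ ν := by
    intro ν
    have h1 : ∀ᶠ ε in nhdsWithin (0 : ℝ) (Set.Ioi 0), ∀ j ∈ Finset.range (ν + 1),
        regError ε (𝓕 (u j) : L2 d) ≤ (1 / 4 : ℝ≥0∞) ^ ν := by
      rw [Filter.eventually_all_finset]
      intro j _
      exact (tendsto_regError (Lp.memLp _)).eventually_le_const (by
        refine pos_iff_ne_zero.2 (pow_ne_zero _ ?_)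
        simp)
    exact ((eventually_mem_of_tendsto_nhdsWithin tendsto_id).and h1).exists
  choose ε hε hle using hex
  refine ⟨ε, hε, fun {U} hU j t => ?_⟩
  set D : ℕ → Rd d → ℂ := fun ν x => regWave (ε ν) (𝓕 (u j) : L2 d) (t, x) - U t (u j) x with hD
  have hDm : ∀ ν, AEMeasurable (fun x => ‖D ν x‖ₑ ^ 2) := fun ν => by
    refine AEMeasurable.pow_const (AEStronglyMeasurable.enorm ?_) 2
    refine AEStronglyMeasurable.sub (Continuous.aestronglyMeasurable ?_)
      (Lp.aestronglyMeasurable _)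
    exact (continuous_regWave (hε ν) (Lp.memLp _)).comp (by fun_prop)
  have hsum : ∫⁻ x, ∑' ν, ‖D (ν + j) x‖ₑ ^ 2 ≠ ∞ := by
    rw [lintegral_tsum fun ν => hDm _]
    refine ne_top_of_le_ne_top (b := ∑' ν : ℕ, (1 / 4 : ℝ≥0∞) ^ ν) ?_
      (ENNReal.tsum_le_tsum fun ν => ?_)
    · rw [ENNReal.tsum_geometric]
      refine ENNReal.inv_ne_top.2 (tsub_pos_of_lt ?_).ne'
      rw [one_div]
      exact ENNReal.inv_lt_one.2 (by norm_num)
    · rw [hU.lintegral_regWave_sub (hε _)]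
      refine (hle (ν + j) j (Finset.mem_range.2 (by omega))).trans ?_
      exact pow_le_pow_right_of_le_one' (by rw [one_div]; exact ENNReal.inv_le_one.2 (by norm_num))
        (by omega)
  filter_upwards [ae_lt_top' (AEMeasurable.tsum fun ν => hDm (ν + j)) hsum] with x hx
  have h0 := ENNReal.tendsto_atTop_zero_of_tsum_ne_top hx.ne
  have h1 : Tendsto (fun ν => ‖D ν x‖ₑ ^ 2) atTop (nhds 0) :=
    (tendsto_add_atTop_iff_nat (f := fun ν => ‖D ν x‖ₑ ^ 2) j).1 h0
  have h2 : Tendsto (fun ν => ‖D ν x‖ₑ) atTop (nhds 0) := by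
    have h3 : ∀ a : ℝ≥0∞, (a ^ 2) ^ (1 / 2 : ℝ) = a := fun a => by
      rw [← ENNReal.rpow_natCast, ← ENNReal.rpow_mul]
      norm_num
    have := h1.ennrpow_const (1 / 2)
    simp only [h3] at this
    rwa [ENNReal.zero_rpow_of_pos (by norm_num)] at this
  rw [tendsto_iff_edist_tendsto_0]
  simpa [hD, edist_eq_enorm_sub] using h2

end Approximation

section Endpoint

variable {d : ℕ}

theorem rpow_tsum_le_liminf {a : ℕ → ℕ → ℝ≥0∞} {b : ℕ → ℝ≥0∞} {q : ℝ} (hq : 0 ≤ q)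
    (h : ∀ j, Tendsto (fun ν => a ν j) atTop (nhds (b j))) :
    (∑' j, b j) ^ q ≤ liminf (fun ν => (∑ j ∈ Finset.range ν, a ν j) ^ q) atTop := by
  refine le_of_tendsto' ((ENNReal.tendsto_nat_tsum b).ennrpow_const q) fun N => ?_
  have h1 : Tendsto (fun ν => (∑ j ∈ Finset.range N, a ν j) ^ q) atTop
      (nhds ((∑ j ∈ Finset.range N, b j) ^ q)) :=
    (tendsto_finsetSum _ fun j _ => h j).ennrpow_const q
  rw [← h1.liminf_eq]
  refine liminf_le_liminf ?_
  filter_upwards [eventually_ge_atTop N] with ν hν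
  exact ENNReal.rpow_le_rpow (Finset.sum_le_sum_of_subset (Finset.range_subset_range.2 hν)) hq

theorem ofReal_rpow_sum_mul_norm_sq {q : ℝ} (hq : 0 ≤ q) {ν : ℕ} (n : ℕ → ℝ≥0) (w : ℕ → ℂ) :
    ENNReal.ofReal ((∑ j : Fin ν, (n j : ℝ) * ‖w j‖ ^ 2) ^ q)
      = (∑ j ∈ Finset.range ν, (n j : ℝ≥0∞) * ‖w j‖ₑ ^ 2) ^ q := by
  rw [← ENNReal.ofReal_rpow_of_nonneg (by positivity) hq, Finset.sum_range,
    ENNReal.ofReal_sum_of_nonneg fun j _ => by positivity]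
  simp only [ENNReal.ofReal_mul NNReal.zero_le_coe, ENNReal.ofReal_coe_nnreal,
    ENNReal.ofReal_pow (norm_nonneg _), ofReal_norm]

theorem exists_lintegral_density_le (hd : 1 ≤ d) :
    ∃ C : ℝ, 0 < C ∧ ∀ {U : ℝ → (L2 d ≃ₗᵢ[ℂ] L2 d)}, IsSchrodingerPropagator U →
      ∀ {u : ℕ → L2 d}, Orthonormal ℂ u → ∀ n : ℕ → ℝ≥0,
        ∫⁻ t, ∫⁻ x, (∑' j, (n j : ℝ≥0∞) * ‖U t (u j) x‖ₑ ^ 2) ^ (1 + 2 / d : ℝ)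
          ≤ (ENNReal.ofReal C * (∑' j, (n j : ℝ≥0∞) ^ ((d + 2 : ℝ) / (d + 1)))
              ^ ((d + 1 : ℝ) / (d + 2))) ^ (1 + 2 / d : ℝ) := by
  obtain ⟨C, hC, hbound⟩ := exists_lintegral_density_regWave_le hd
  refine ⟨C, hC, fun {U} hU {u} hu n => ?_⟩
  have hq : (0 : ℝ) ≤ 1 + 2 / d := by positivity
  obtain ⟨ε, hε, htend⟩ := IsSchrodingerPropagator.exists_tendsto_regWave u
  set ρ : ℕ → ℝ × Rd d → ℝ≥0∞ := fun ν X => (∑ j ∈ Finset.range ν,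
    (n j : ℝ≥0∞) * ‖regWave (ε ν) (𝓕 (u j) : L2 d) X‖ₑ ^ 2) ^ (1 + 2 / d : ℝ) with hρ
  have hρm : ∀ ν, Measurable (ρ ν) := fun ν => by
    refine Measurable.pow_const (Finset.measurable_fun_sum _ fun j _ => ?_) _
    exact ((continuous_regWave (hε ν) (Lp.memLp _)).measurable.enorm.pow_const 2).const_mul _
  have hρle : ∀ ν, ∫⁻ t, ∫⁻ x, ρ ν (t, x)
      ≤ (ENNReal.ofReal C * (∑' j, (n j : ℝ≥0∞) ^ ((d + 2 : ℝ) / (d + 1)))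
              ^ ((d + 1 : ℝ) / (d + 2))) ^ (1 + 2 / d : ℝ) := fun ν => by
    have hv : Orthonormal ℂ fun j : Fin ν => (𝓕 (u j) : L2 d) :=
      (hu.comp_linearIsometryEquiv (Lp.fourierTransformₗᵢ (Rd d) ℂ)).comp
        (fun j : Fin ν => (j : ℕ)) Fin.val_injective
    rw [← lintegral_prod _ (hρm ν).aemeasurable, ← Measure.volume_eq_prod]
    have h := hbound (hε ν) hv (n := fun j => (n j : ℝ)) fun j => (n j).2
    refine ((lintegral_congr fun X => ?_).trans_le h).trans ?_
    · exact (ofReal_rpow_sum_mul_norm_sq hq n fun j => regWave (ε ν) (𝓕 (u j) : L2 d) X).symm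
    rw [← ENNReal.ofReal_rpow_of_nonneg (by positivity) hq, ENNReal.ofReal_mul hC.le,
      ← ENNReal.ofReal_rpow_of_nonneg (by positivity) (by positivity),
      ENNReal.ofReal_sum_of_nonneg fun j _ => by positivity]
    gcongr
    refine le_trans (le_of_eq ?_) (ENNReal.sum_le_tsum (Finset.range ν))
    rw [Finset.sum_range]
    refine Finset.sum_congr rfl fun j _ => ?_
    rw [← ENNReal.ofReal_rpow_of_nonneg (by positivity) (by positivity),
      ENNReal.ofReal_coe_nnreal]
  calc _ ≤ ∫⁻ t, ∫⁻ x, liminf (fun ν => ρ ν (t, x)) atTop := by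
        refine lintegral_mono fun t => lintegral_mono_ae ?_
        filter_upwards [ae_all_iff.2 fun j => htend hU j t] with x hx
        refine rpow_tsum_le_liminf hq fun j => ?_
        exact ENNReal.Tendsto.const_mul (((ENNReal.continuous_pow 2).tendsto _).comp (hx j).enorm)
          (Or.inr ENNReal.coe_ne_top)
    _ ≤ ∫⁻ t, liminf (fun ν => ∫⁻ x, ρ ν (t, x)) atTop :=
        lintegral_mono fun t => lintegral_liminf_le fun ν => (hρm ν).comp measurable_prodMk_left
    _ ≤ liminf (fun ν => ∫⁻ t, ∫⁻ x, ρ ν (t, x)) atTop :=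
        lintegral_liminf_le fun ν => (hρm ν).lintegral_prod_right'
    _ ≤ _ := liminf_le_of_le (by isBoundedDefault) fun b hb =>
        (hb.exists.choose_spec).trans (hρle _)

end Endpoint

section Interpolation

variable {d : ℕ}

theorem tsum_mul_le_rpow_mul_rpow (m : ℕ → ℝ≥0) (K : ℕ → ℝ≥0∞) {α r θ : ℝ} (hα : 0 ≤ α)
    (hr : 0 ≤ r) (hθ : 0 ≤ θ) (hθ1 : θ ≤ 1) (h : α * (1 - θ) + r * θ = 1) :
    ∑' j, (m j : ℝ≥0∞) * K j
      ≤ (∑' j, (m j : ℝ≥0∞) ^ α * K j) ^ (1 - θ) * (∑' j, (m j : ℝ≥0∞) ^ r * K j) ^ θ := by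
  have hθ' : 0 ≤ 1 - θ := sub_nonneg.2 hθ1
  have hH := ENNReal.lintegral_mul_norm_pow_le (μ := Measure.count)
    (f := fun j => (m j : ℝ≥0∞) ^ α * K j) (g := fun j => (m j : ℝ≥0∞) ^ r * K j)
    (measurable_from_top).aemeasurable (measurable_from_top).aemeasurable hθ' hθ (by ring)
  simp only [lintegral_count] at hH
  refine le_trans (le_of_eq (tsum_congr fun j => ?_)) hH
  rw [ENNReal.mul_rpow_of_nonneg _ _ hθ', ENNReal.mul_rpow_of_nonneg _ _ hθ,
    mul_mul_mul_comm, ← ENNReal.rpow_mul, ← ENNReal.rpow_mul,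
    ← ENNReal.rpow_add_of_nonneg _ _ (by positivity) (by positivity),
    ← ENNReal.rpow_add_of_nonneg _ _ hθ' hθ, h]
  simp

theorem lintegral_rpow_mul_rpow_le {α : Type*} [MeasurableSpace α] {μ : Measure α}
    {A B : α → ℝ≥0∞} (hA : AEMeasurable A μ) (hB : AEMeasurable B μ) {θ p q q₁ : ℝ}
    (hθ1 : θ ≤ 1) (hq : 0 < q) (hp : 0 < p) (hq₁ : 0 < q₁)
    (hqθ : (1 - θ) * q + θ * q / q₁ = 1) (hpθ : θ * p = q₁) :
    (∫⁻ x, (A x ^ (1 - θ) * B x ^ θ) ^ q ∂μ) ^ (p / q)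
      ≤ (∫⁻ x, A x ∂μ) ^ ((1 - θ) * p) * ∫⁻ x, B x ^ q₁ ∂μ := by
  have hθ0 : 0 < θ := pos_of_mul_pos_left (hpθ ▸ hq₁) hp.le
  have hθ := hθ0.le
  have hθ' : 0 ≤ 1 - θ := sub_nonneg.2 hθ1
  have hH := ENNReal.lintegral_mul_norm_pow_le (μ := μ) hA (hB.pow_const q₁)
    (p := (1 - θ) * q) (q := θ * q / q₁) (by positivity) (by positivity) hqθ
  have heq : ∀ x, (A x ^ (1 - θ) * B x ^ θ) ^ q
      = A x ^ ((1 - θ) * q) * (B x ^ q₁) ^ (θ * q / q₁) := fun x => by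
    rw [ENNReal.mul_rpow_of_nonneg _ _ hq.le, ← ENNReal.rpow_mul, ← ENNReal.rpow_mul,
      ← ENNReal.rpow_mul, mul_div_cancel₀ _ hq₁.ne']
  rw [lintegral_congr heq]
  refine (ENNReal.rpow_le_rpow hH (by positivity)).trans (le_of_eq ?_)
  have e1 : (1 - θ) * q * (p / q) = (1 - θ) * p := by field_simp
  have e2 : θ * q / q₁ * (p / q) = 1 := by rw [← hpθ]; field_simp
  rw [ENNReal.mul_rpow_of_nonneg _ _ (by positivity), ← ENNReal.rpow_mul, ← ENNReal.rpow_mul, e1,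
    e2, ENNReal.rpow_one]

theorem lintegral_tsum_mul_enorm_sq {U : L2 d ≃ₗᵢ[ℂ] L2 d} {u : ℕ → L2 d} (hu : Orthonormal ℂ u)
    (a : ℕ → ℝ≥0∞) : ∫⁻ x, ∑' j, a j * ‖U (u j) x‖ₑ ^ 2 = ∑' j, a j := by
  have hm : ∀ j, AEMeasurable (fun x => ‖U (u j) x‖ₑ ^ 2) := fun j =>
    (Lp.aestronglyMeasurable _).enorm.pow_const 2
  rw [lintegral_tsum fun j => (hm j).const_mul _]
  refine tsum_congr fun j => ?_
  rw [lintegral_const_mul'' _ (hm j), lintegral_enorm_sq_Lp, U.norm_map, hu.1 j]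
  simp

theorem enorm_tsum_mul_ofReal_le (n z : ℕ → ℂ) :
    (‖∑' j, n j * ((‖z j‖ ^ 2 : ℝ) : ℂ)‖₊ : ℝ≥0∞) ≤ ∑' j, (‖n j‖₊ : ℝ≥0∞) * ‖z j‖ₑ ^ 2 := by
  refine (enorm_tsum_le_tsum_enorm (f := fun j => n j * ((‖z j‖ ^ 2 : ℝ) : ℂ))).trans
    (le_of_eq (tsum_congr fun j => ?_))
  rw [enorm_mul, ← enorm_eq_nnnorm, ← ofReal_norm ((‖z j‖ ^ 2 : ℝ) : ℂ), norm_real, norm_pow,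
    norm_norm, ENNReal.ofReal_pow (norm_nonneg _), ofReal_norm]

end Interpolation

/-- **Strichartz inequality for orthonormal functions** (Theorem 1).
If `1 < q ≤ 1 + 2/d` and `2/p + d/q = d`, then there is a constant `C = C(d,q) > 0` such that
for every orthonormal system `(u_j)` in `L²(ℝ^d)` and all coefficients `(n_j) ⊆ ℂ`,
`∫_ℝ (∫_{ℝ^d} |∑_j n_j |(e^{itΔ}u_j)(x)|²|^q dx)^{p/q} dt
  ≤ C^p (∑_j |n_j|^{2q/(q+1)})^{p(q+1)/(2q)}`. -/
theorem strichartz_orthonormal (d : ℕ) (hd : 1 ≤ d) (p q : ℝ)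
    (hq1 : 1 < q) (hq2 : q ≤ 1 + 2 / d) (hpq : 2 / p + d / q = d) :
    ∃ C : ℝ, 0 < C ∧
      ∀ (U : ℝ → (L2 d ≃ₗᵢ[ℂ] L2 d)), IsSchrodingerPropagator U →
      ∀ u : ℕ → L2 d, Orthonormal ℂ u →
      ∀ n : ℕ → ℂ,
        (∫⁻ t : ℝ, (∫⁻ x : Rd d,
              (‖∑' j : ℕ, n j * ((‖((U t) (u j) : Rd d → ℂ) x‖ ^ 2 : ℝ) : ℂ)‖₊ : ℝ≥0∞) ^ q
            ∂volume) ^ (p / q) ∂volume)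
          ≤ (ENNReal.ofReal C) ^ p
            * (∑' j : ℕ, (‖n j‖₊ : ℝ≥0∞) ^ (2 * q / (q + 1))) ^ (p * (q + 1) / (2 * q)) := by
  have hd0 : (0 : ℝ) < d := by exact_mod_cast hd
  have hq0 : 0 < q := by linarith
  have hq1' : (0 : ℝ) < 1 + 2 / d := by positivity
  have hp : 0 < p := by
    have h1 : (d : ℝ) / q < d := div_lt_self hd0 hq1
    have h2 : 0 < 2 / p := by linarith
    exact (div_pos_iff_of_pos_left two_pos).1 h2
  obtain ⟨C, hC, hbound⟩ := exists_lintegral_density_le hd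
  set θ : ℝ := (1 + 2 / d) / p with hθ
  have hθ0 : 0 < θ := by positivity
  have hpθ : θ * p = 1 + 2 / d := div_mul_cancel₀ _ hp.ne'
  have hθq : θ = (d + 2) * (q - 1) / (2 * q) := by
    have hpval : p = 2 * q / (d * (q - 1)) := by
      have : q - 1 ≠ 0 := by linarith
      field_simp at hpq ⊢
      linarith
    have : q - 1 ≠ 0 := by linarith
    rw [hθ, hpval]
    field_simp
  have hθ1 : θ ≤ 1 := by
    rw [hθq, div_le_one (by positivity)]
    have : q * d ≤ d + 2 := by
      calc q * d ≤ (1 + 2 / d) * d := by gcongr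
        _ = _ := by field_simp
    linarith
  set α : ℝ := 2 * q / (q + 1) with hα
  have hα0 : 0 < α := by positivity
  set r : ℝ := α * ((d + 1) / (d + 2)) with hr
  have hr0 : 0 < r := by positivity
  have hαr : α * (1 - θ) + r * θ = 1 := by
    rw [hr, hα, hθq]; field_simp; ring
  have hqθ : (1 - θ) * q + θ * q / (1 + 2 / d) = 1 := by
    rw [hθq]; field_simp; ring
  refine ⟨C ^ θ, by positivity, fun U hU u hu n => ?_⟩
  set S : ℝ≥0∞ := ∑' j, (‖n j‖₊ : ℝ≥0∞) ^ α with hS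
  have hexp : p * (q + 1) / (2 * q) = (1 - θ) * p + (d + 1) / (d + 2) * (1 + 2 / d) := by
    rw [← hpθ, hθq]; field_simp; ring
  have hCp : ENNReal.ofReal (C ^ θ) ^ p = ENNReal.ofReal C ^ (1 + 2 / d : ℝ) := by
    rw [← ENNReal.ofReal_rpow_of_pos hC, ← ENNReal.rpow_mul, hpθ]
  rw [hCp]
  rcases eq_or_ne S ∞ with hS' | hS'
  · rw [hS', ENNReal.top_rpow_of_pos (by positivity), ENNReal.mul_top]
    · exact le_top
    · exact (ENNReal.rpow_pos (ENNReal.ofReal_pos.2 hC) ENNReal.ofReal_ne_top).ne'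
  have hcoe : ∀ j, ((‖n j‖₊ ^ r : ℝ≥0) : ℝ≥0∞) = (‖n j‖₊ : ℝ≥0∞) ^ r := fun j =>
    ENNReal.coe_rpow_of_nonneg _ hr0.le
  have hpt : ∀ t, (∫⁻ x : Rd d,
        (‖∑' j : ℕ, n j * ((‖((U t) (u j) : Rd d → ℂ) x‖ ^ 2 : ℝ) : ℂ)‖₊ : ℝ≥0∞) ^ q) ^ (p / q)
      ≤ S ^ ((1 - θ) * p) * ∫⁻ x, (∑' j, ((‖n j‖₊ ^ r : ℝ≥0) : ℝ≥0∞) * ‖U t (u j) x‖ₑ ^ 2)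
        ^ (1 + 2 / d : ℝ) := by
    intro t
    have hm : ∀ a : ℕ → ℝ≥0∞, AEMeasurable fun x => ∑' j, a j * ‖U t (u j) x‖ₑ ^ 2 := fun a =>
      AEMeasurable.tsum fun j => ((Lp.aestronglyMeasurable _).enorm.pow_const 2).const_mul _
    rw [hS, ← lintegral_tsum_mul_enorm_sq (U := U t) hu]
    refine le_trans ?_ (lintegral_rpow_mul_rpow_le (hm _) (hm _) hθ1 hq0 hp hq1' hqθ hpθ)
    refine ENNReal.rpow_le_rpow (lintegral_mono fun x => ENNReal.rpow_le_rpow ?_ hq0.le)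
      (by positivity)
    simp only [hcoe]
    exact (enorm_tsum_mul_ofReal_le n fun j => U t (u j) x).trans
      (tsum_mul_le_rpow_mul_rpow _ _ hα0.le hr0.le hθ0.le hθ1 hαr)
  have hSr : ∑' j, ((‖n j‖₊ ^ r : ℝ≥0) : ℝ≥0∞) ^ ((d + 2 : ℝ) / (d + 1)) = S := by
    refine tsum_congr fun j => ?_
    rw [hcoe, ← ENNReal.rpow_mul, hr]
    congr 1
    field_simp
  calc _ ≤ ∫⁻ t, S ^ ((1 - θ) * p) * ∫⁻ x, (∑' j, ((‖n j‖₊ ^ r : ℝ≥0) : ℝ≥0∞)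
          * ‖U t (u j) x‖ₑ ^ 2) ^ (1 + 2 / d : ℝ) := lintegral_mono hpt
    _ = S ^ ((1 - θ) * p) * ∫⁻ t, ∫⁻ x, (∑' j, ((‖n j‖₊ ^ r : ℝ≥0) : ℝ≥0∞)
          * ‖U t (u j) x‖ₑ ^ 2) ^ (1 + 2 / d : ℝ) :=
        lintegral_const_mul' _ _
          (ENNReal.rpow_ne_top_of_nonneg (mul_nonneg (sub_nonneg.2 hθ1) hp.le) hS')
    _ ≤ S ^ ((1 - θ) * p)
          * (ENNReal.ofReal C * S ^ ((d + 1 : ℝ) / (d + 2))) ^ (1 + 2 / d : ℝ) := by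
        have h := hbound hU hu fun j => ‖n j‖₊ ^ r
        rw [hSr] at h
        exact mul_le_mul_right h _
    _ = _ := by
        rw [hexp, ENNReal.mul_rpow_of_nonneg _ _ hq1'.le, ← ENNReal.rpow_mul,
          ENNReal.rpow_add_of_nonneg _ _ (mul_nonneg (sub_nonneg.2 hθ1) hp.le) (by positivity)]
        ring
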